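/- arXiv:hep-th/0008071 — 3 statements merged into one kernel-verified Lean document; each statement's English description precedes it below -/
import Mathlib

section
/- For every integer n ≥ 1 and every complex u at which all of the infinite products defining a(u+ν_n), a(u−ν_n), a(u+ν_0), a(u−ν_0) converge to nonzero values, one has a(u+ν_n) a(u−ν_n) / (a(u+ν_0) a(u−ν_0)) = a^1_n(u); that is, the ratio of the infinite Gamma-function products collapses to the indicated finite product of trigonometric blocks. -/
open Complex Real Filter Topology

/-- The `l`-th factor of the infinite Gamma product defining `ρ(u)`. -/
noncomputable def rhoBlock (lam : ℝ) (u : ℂ) (l : ℕ) : ℂ :=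
  (Complex.Gamma ((2 * (l : ℂ) - 2) * (lam : ℂ) - (lam : ℂ) * u / (Real.pi : ℂ)) *
   Complex.Gamma (1 + 2 * (l : ℂ) * (lam : ℂ) - (lam : ℂ) * u / (Real.pi : ℂ)) *
   Complex.Gamma ((2 * (l : ℂ) - 1) * (lam : ℂ) + (lam : ℂ) * u / (Real.pi : ℂ)) *
   Complex.Gamma (1 + (2 * (l : ℂ) - 1) * (lam : ℂ) + (lam : ℂ) * u / (Real.pi : ℂ))) /
  (Complex.Gamma ((2 * (l : ℂ) - 1) * (lam : ℂ) - (lam : ℂ) * u / (Real.pi : ℂ)) *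
   Complex.Gamma (1 + (2 * (l : ℂ) - 1) * (lam : ℂ) - (lam : ℂ) * u / (Real.pi : ℂ)) *
   Complex.Gamma ((2 * (l : ℂ) - 2) * (lam : ℂ) + (lam : ℂ) * u / (Real.pi : ℂ)) *
   Complex.Gamma (1 + 2 * (l : ℂ) * (lam : ℂ) + (lam : ℂ) * u / (Real.pi : ℂ)))

/-- The `L`-th partial product defining the soliton-soliton amplitude
`a(u) = sin(λ(π−u)) ρ(u)`, with `ρ(u) = (1/sin(λ(u−π))) ∏_{l=1}^{∞} (Gamma block)`. -/
noncomputable def aPartial (lam : ℝ) (u : ℂ) (L : ℕ) : ℂ :=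
  Complex.sin ((lam : ℂ) * ((Real.pi : ℂ) - u)) *
    ((1 / Complex.sin ((lam : ℂ) * (u - (Real.pi : ℂ)))) *
      ∏ l ∈ Finset.Icc 1 L, rhoBlock lam u l)

/-- For a real parameter `y`, the trigonometric block
`(y)_u := sin((u+πy)/2)/sin((u−πy)/2)`. -/
noncomputable def blk (y : ℝ) (u : ℂ) : ℂ :=
  Complex.sin ((u + (Real.pi * y : ℝ)) / 2) / Complex.sin ((u - (Real.pi * y : ℝ)) / 2)

/-- The factor `a^1_n(u)` of the excited boundary reflection amplitudes. -/
noncomputable def a1 (lam ξ : ℝ) (n : ℕ) (u : ℂ) : ℂ :=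
  ∏ x ∈ Finset.Icc 1 n,
    (blk (ξ / (lam * Real.pi) + 1 / (2 * lam) - (x : ℝ) / lam) u *
     blk (ξ / (lam * Real.pi) - 1 / (2 * lam) - (x : ℝ) / lam) u) /
    (blk (ξ / (lam * Real.pi) + 1 / (2 * lam) - (x : ℝ) / lam + 1) u *
     blk (ξ / (lam * Real.pi) - 1 / (2 * lam) - (x : ℝ) / lam + 1) u)

/-- The candidate soliton boundary-binding rapidity `ν_n = ξ/λ − (2n+1)π/(2λ)`. -/
noncomputable def nuP (lam ξ : ℝ) (n : ℕ) : ℝ :=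
  ξ / lam - (2 * (n : ℝ) + 1) * Real.pi / (2 * lam)


noncomputable def rhoB (lam : ℝ) (p : ℂ) (l : ℕ) : ℂ :=
  (Complex.Gamma ((2 * (l : ℂ) - 2) * (lam : ℂ) - p) *
   Complex.Gamma (1 + 2 * (l : ℂ) * (lam : ℂ) - p) *
   Complex.Gamma ((2 * (l : ℂ) - 1) * (lam : ℂ) + p) *
   Complex.Gamma (1 + (2 * (l : ℂ) - 1) * (lam : ℂ) + p)) /
  (Complex.Gamma ((2 * (l : ℂ) - 1) * (lam : ℂ) - p) *
   Complex.Gamma (1 + (2 * (l : ℂ) - 1) * (lam : ℂ) - p) *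
   Complex.Gamma ((2 * (l : ℂ) - 2) * (lam : ℂ) + p) *
   Complex.Gamma (1 + 2 * (l : ℂ) * (lam : ℂ) + p))

def GP (lam : ℝ) (p : ℂ) : Prop := ∀ l : ℕ, 1 ≤ l →
  Complex.Gamma ((2 * (l : ℂ) - 2) * (lam : ℂ) + p) ≠ 0 ∧
  Complex.Gamma (1 + 2 * (l : ℂ) * (lam : ℂ) + p) ≠ 0 ∧
  Complex.Gamma ((2 * (l : ℂ) - 1) * (lam : ℂ) + p) ≠ 0 ∧
  Complex.Gamma (1 + (2 * (l : ℂ) - 1) * (lam : ℂ) + p) ≠ 0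

lemma gam_aux {s : ℂ} (h : Complex.Gamma s ≠ 0) :
    s ≠ 0 ∧ Complex.Gamma (s + 1) = s * Complex.Gamma s ∧ Complex.Gamma (s + 1) ≠ 0 := by
  have h0 : s ≠ 0 := by
    rintro rfl
    exact h Complex.Gamma_zero
  have h1 := Complex.Gamma_add_one s h0
  exact ⟨h0, h1, by rw [h1]; exact mul_ne_zero h0 h⟩

lemma GP_succ {lam : ℝ} {p : ℂ} (h : GP lam p) : GP lam (p + 1) := by
  intro l hl
  obtain ⟨h1, h2, h3, h4⟩ := h l hl
  simp only [← add_assoc]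
  exact ⟨(gam_aux h1).2.2, (gam_aux h2).2.2, (gam_aux h3).2.2, (gam_aux h4).2.2⟩

lemma GP_add {lam : ℝ} {p : ℂ} (h : GP lam p) (n : ℕ) : GP lam (p + n) := by
  induction n with
  | zero => simpa using h
  | succ k ih => push_cast; rw [← add_assoc]; exact GP_succ ih

/-- ratio of consecutive blocks -/
noncomputable def Fct (lam : ℝ) (p : ℂ) (l : ℕ) : ℂ :=
  (((2 * (l : ℂ) - 2) * lam - p) * (2 * l * lam + p) *
    ((2 * (l : ℂ) - 2) * lam + (p - 1)) * (2 * l * lam - (p - 1))) /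
  ((((2 * (l : ℂ) - 1) * lam) ^ 2 - p ^ 2) * (((2 * (l : ℂ) - 1) * lam) ^ 2 - (p - 1) ^ 2))

lemma rhoB_step {lam : ℝ} {p : ℂ} (hn : GP lam (-p)) (hp : GP lam (p - 1)) (l : ℕ) (hl : 1 ≤ l) :
    rhoB lam (p - 1) l = rhoB lam p l * Fct lam p l := by
  obtain ⟨h1, h2, h3, h4⟩ := hn l hl
  obtain ⟨k1, k2, k3, k4⟩ := hp l hl
  obtain ⟨a1, b1, c1⟩ := gam_aux h1
  obtain ⟨a2, b2, c2⟩ := gam_aux h2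
  obtain ⟨a3, b3, c3⟩ := gam_aux h3
  obtain ⟨a4, b4, c4⟩ := gam_aux h4
  obtain ⟨a5, b5, c5⟩ := gam_aux k1
  obtain ⟨a6, b6, c6⟩ := gam_aux k2
  obtain ⟨a7, b7, c7⟩ := gam_aux k3
  obtain ⟨a8, b8, c8⟩ := gam_aux k4
  unfold rhoB Fct
  rw [show (2 * (l : ℂ) - 2) * (lam : ℂ) - (p - 1) = (2 * (l : ℂ) - 2) * (lam : ℂ) + -p + 1 by ring,
    show 1 + 2 * (l : ℂ) * (lam : ℂ) - (p - 1) = 1 + 2 * (l : ℂ) * (lam : ℂ) + -p + 1 by ring,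
    show (2 * (l : ℂ) - 1) * (lam : ℂ) - (p - 1) = (2 * (l : ℂ) - 1) * (lam : ℂ) + -p + 1 by ring,
    show 1 + (2 * (l : ℂ) - 1) * (lam : ℂ) - (p - 1)
      = 1 + (2 * (l : ℂ) - 1) * (lam : ℂ) + -p + 1 by ring,
    show (2 * (l : ℂ) - 2) * (lam : ℂ) + p = (2 * (l : ℂ) - 2) * (lam : ℂ) + (p - 1) + 1 by ring,
    show 1 + 2 * (l : ℂ) * (lam : ℂ) + p = 1 + 2 * (l : ℂ) * (lam : ℂ) + (p - 1) + 1 by ring,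
    show (2 * (l : ℂ) - 1) * (lam : ℂ) + p = (2 * (l : ℂ) - 1) * (lam : ℂ) + (p - 1) + 1 by ring,
    show 1 + (2 * (l : ℂ) - 1) * (lam : ℂ) + p
      = 1 + (2 * (l : ℂ) - 1) * (lam : ℂ) + (p - 1) + 1 by ring,
    show ((2 * (l : ℂ) - 1) * lam) ^ 2 - p ^ 2 = ((2 * (l : ℂ) - 1) * (lam : ℂ) + -p) *
      (1 + (2 * (l : ℂ) - 1) * (lam : ℂ) + (p - 1)) by ring,
    show ((2 * (l : ℂ) - 1) * lam) ^ 2 - (p - 1) ^ 2 = (1 + (2 * (l : ℂ) - 1) * (lam : ℂ) + -p) *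
      ((2 * (l : ℂ) - 1) * (lam : ℂ) + (p - 1)) by ring,
    show 2 * (l : ℂ) * lam + p = 1 + 2 * (l : ℂ) * (lam : ℂ) + (p - 1) by ring,
    show 2 * (l : ℂ) * lam - (p - 1) = 1 + 2 * (l : ℂ) * (lam : ℂ) + -p by ring,
    b1, b2, b3, b4, b5, b6, b7, b8]
  simp only [sub_eq_add_neg _ p]
  generalize Complex.Gamma _ = g1 at *
  generalize Complex.Gamma _ = g2 at *
  generalize Complex.Gamma _ = g3 at *
  generalize Complex.Gamma _ = g4 at *
  generalize Complex.Gamma _ = g5 at *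
  generalize Complex.Gamma _ = g6 at *
  generalize Complex.Gamma _ = g7 at *
  generalize Complex.Gamma _ = g8 at *
  generalize (2 * (l : ℂ) - 2) * (lam : ℂ) + -p = x1 at *
  generalize 1 + 2 * (l : ℂ) * (lam : ℂ) + -p = x2 at *
  generalize (2 * (l : ℂ) - 1) * (lam : ℂ) + -p = x3 at *
  generalize 1 + (2 * (l : ℂ) - 1) * (lam : ℂ) + -p = x4 at *
  generalize (2 * (l : ℂ) - 2) * (lam : ℂ) + (p - 1) = x5 at *
  generalize 1 + 2 * (l : ℂ) * (lam : ℂ) + (p - 1) = x6 at *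
  generalize (2 * (l : ℂ) - 1) * (lam : ℂ) + (p - 1) = x7 at *
  generalize 1 + (2 * (l : ℂ) - 1) * (lam : ℂ) + (p - 1) = x8 at *
  field_simp

lemma ne_int {lam : ℝ} {p : ℂ} (hn : GP lam (-p)) (hp : GP lam (p - 1)) (k : ℤ) :
    p ≠ k * lam ∧ p - 1 ≠ k * lam := by
  have key : ∀ k : ℕ, ((k : ℂ) * lam - p ≠ 0 ∧ ((k : ℂ) + 1) * lam + p ≠ 0) ∧
      ((k : ℂ) * lam + (p - 1) ≠ 0 ∧ ((k : ℂ) + 1) * lam - (p - 1) ≠ 0) := by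
    intro k
    obtain ⟨j, rfl | rfl⟩ := Nat.even_or_odd' k
    · obtain ⟨h1, h2, h3, h4⟩ := hn (j + 1) (by omega)
      obtain ⟨k1, k2, k3, k4⟩ := hp (j + 1) (by omega)
      refine ⟨⟨?_, ?_⟩, ?_, ?_⟩
      · convert (gam_aux h1).1 using 1; push_cast; ring
      · convert (gam_aux k4).1 using 1; push_cast; ring
      · convert (gam_aux k1).1 using 1; push_cast; ring
      · convert (gam_aux h4).1 using 1; push_cast; ring
    · obtain ⟨h1, h2, h3, h4⟩ := hn (j + 1) (by omega)
      obtain ⟨k1, k2, k3, k4⟩ := hp (j + 1) (by omega)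
      refine ⟨⟨?_, ?_⟩, ?_, ?_⟩
      · convert (gam_aux h3).1 using 1; push_cast; ring
      · convert (gam_aux k2).1 using 1; push_cast; ring
      · convert (gam_aux k3).1 using 1; push_cast; ring
      · convert (gam_aux h2).1 using 1; push_cast; ring
  rcases k with k | k
  · constructor
    · intro h
      apply (key k).1.1
      rw [h]; simp
    · intro h
      rcases k with _ | k
      · apply (key 0).2.1
        rw [h]; simp
      · apply (key k).2.2
        rw [h]; simp
  · constructor
    · intro h
      apply (key k).1.2
      rw [h]; push_cast; ring
    · intro h
      apply (key (k + 1)).2.1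
      rw [h]; push_cast; ring

noncomputable def KK (L : ℕ) (a : ℂ) : ℂ :=
  ∏ i ∈ Finset.range L, (((2 * (i : ℂ) + 2) ^ 2 - a ^ 2) / ((2 * (i : ℂ) + 1) ^ 2 - a ^ 2))

noncomputable def SS (L : ℕ) (a : ℂ) : ℂ :=
  (Real.pi : ℂ) * a * ∏ j ∈ Finset.range L, (1 - a ^ 2 / ((j : ℂ) + 1) ^ 2)

lemma KK_SS (a : ℂ) (ha : ∀ k : ℤ, a ≠ k) (L : ℕ) :
    (Real.pi : ℂ) * a / 4 * KK L a * SS (2 * L) a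
      = SS L (a / 2) ^ 2 * (2 * L + 1) * ((Real.Wallis.W L : ℝ) : ℂ) := by
  induction L with
  | zero => simp [KK, SS, Real.Wallis.W]; ring
  | succ L ih =>
    have e1 : KK (L + 1) a = KK L a *
        (((2 * (L : ℂ) + 2) ^ 2 - a ^ 2) / ((2 * (L : ℂ) + 1) ^ 2 - a ^ 2)) := by
      rw [KK, KK, Finset.prod_range_succ]
    have e2 : SS (2 * (L + 1)) a = SS (2 * L) a * (1 - a ^ 2 / (2 * (L : ℂ) + 1) ^ 2) *
        (1 - a ^ 2 / (2 * (L : ℂ) + 2) ^ 2) := by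
      simp only [SS, show 2 * (L + 1) = 2 * L + 1 + 1 by ring, Finset.prod_range_succ]
      push_cast; ring
    have e3 : SS (L + 1) (a / 2) = SS L (a / 2) * (1 - (a / 2) ^ 2 / ((L : ℂ) + 1) ^ 2) := by
      simp only [SS, Finset.prod_range_succ]; ring
    have e4 : ((Real.Wallis.W (L + 1) : ℝ) : ℂ) = ((Real.Wallis.W L : ℝ) : ℂ) *
        ((2 * L + 2) / (2 * L + 1) * ((2 * L + 2) / (2 * L + 3))) := by
      rw [Real.Wallis.W_succ]; push_cast; ring
    have n1 : (2 * (L : ℂ) + 1) ≠ 0 := by exact_mod_cast (by omega : 2 * L + 1 ≠ 0)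
    have n3 : (2 * (L : ℂ) + 3) ≠ 0 := by exact_mod_cast (by omega : 2 * L + 3 ≠ 0)
    have n2 : ((L : ℂ) + 1) ≠ 0 := by exact_mod_cast (by omega : L + 1 ≠ 0)
    have n4 : (2 * (L : ℂ) + 1) ^ 2 - a ^ 2 ≠ 0 := by
      rw [show (2 * (L : ℂ) + 1) ^ 2 - a ^ 2 = (2 * L + 1 - a) * (2 * L + 1 + a) by ring]
      refine mul_ne_zero (fun h => ha (2 * L + 1) ?_) (fun h => ha (-(2 * L + 1)) ?_)
      · push_cast; linear_combination -h
      · push_cast; linear_combination h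
    calc _ = ((Real.pi : ℂ) * a / 4 * KK L a * SS (2 * L) a) *
          ((((2 * (L : ℂ) + 2) ^ 2 - a ^ 2) / ((2 * (L : ℂ) + 1) ^ 2 - a ^ 2)) *
           (1 - a ^ 2 / (2 * (L : ℂ) + 1) ^ 2) * (1 - a ^ 2 / (2 * (L : ℂ) + 2) ^ 2)) := by
            rw [e1, e2]; ring
      _ = _ := by
        rw [ih, e3, e4, show (2 * (L : ℂ) + 2) = 2 * (L + 1) by ring]
        push_cast
        field_simp
        ring

lemma SS_tendsto (a : ℂ) : Tendsto (fun L => SS L a) atTop (𝓝 (Complex.sin (Real.pi * a))) :=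
  Complex.tendsto_euler_sin_prod a

lemma KK_tendsto (a : ℂ) (ha : ∀ k : ℤ, a ≠ k) :
    Tendsto (fun L : ℕ => a * KK L a / (2 * L + 1)) atTop
      (𝓝 (Complex.tan (Real.pi * a / 2))) := by
  have hs : Complex.sin (Real.pi * a) ≠ 0 := by
    intro h
    obtain ⟨k, hk⟩ := Complex.sin_eq_zero_iff.1 h
    apply ha k
    have : (Real.pi : ℂ) ≠ 0 := by exact_mod_cast Real.pi_ne_zero
    rw [mul_comm] at hk
    exact mul_right_cancel₀ this hk
  have hpi : (Real.pi : ℂ) ≠ 0 := by exact_mod_cast Real.pi_ne_zero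
  have t1 := SS_tendsto (a / 2)
  have t2 : Tendsto (fun L : ℕ => SS (2 * L) a) atTop (𝓝 (Complex.sin (Real.pi * a))) :=
    (SS_tendsto a).comp (tendsto_id.const_mul_atTop' (by norm_num : 0 < 2))
  have t3 : Tendsto (fun L : ℕ => ((Real.Wallis.W L : ℝ) : ℂ)) atTop
      (𝓝 ((Real.pi / 2 : ℝ) : ℂ)) :=
    (Complex.continuous_ofReal.tendsto _).comp Real.Wallis.tendsto_W_nhds_pi_div_two
  have t4 := (((t1.pow 2).mul t3).div t2 hs).const_mul (4 / (Real.pi : ℂ))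
  have hlim : 4 / (Real.pi : ℂ) * (Complex.sin (Real.pi * (a / 2)) ^ 2 * ((Real.pi / 2 : ℝ) : ℂ) /
      Complex.sin (Real.pi * a)) = Complex.tan (Real.pi * a / 2) := by
    have h2 : Complex.sin (Real.pi * a) =
        2 * Complex.sin (Real.pi * a / 2) * Complex.cos (Real.pi * a / 2) := by
      rw [← Complex.sin_two_mul]; congr 1; ring
    rw [h2] at hs ⊢
    have hs1 : Complex.sin (Real.pi * a / 2) ≠ 0 := fun h => hs (by rw [h]; ring)
    have hs2 : Complex.cos (Real.pi * a / 2) ≠ 0 := fun h => hs (by rw [h]; ring)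
    rw [Complex.tan, ← mul_div_assoc (Real.pi : ℂ)]
    push_cast
    field_simp
    try ring
  rw [hlim] at t4
  refine t4.congr' ?_
  filter_upwards [t2.eventually_ne hs] with L hL
  have := KK_SS a ha L
  have n1 : (2 * (L : ℂ) + 1) ≠ 0 := by exact_mod_cast (by omega : 2 * L + 1 ≠ 0)
  simp only [Pi.div_apply]
  field_simp
  linear_combination (-4) * this

lemma Fct_prod {lam : ℝ} (hlam : (lam : ℂ) ≠ 0) {p : ℂ} 
    (h : ∀ k : ℤ, p ≠ k * lam ∧ p - 1 ≠ k * lam) (L : ℕ) :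
    ∏ l ∈ Finset.Icc 1 L, Fct lam p l =
      -(p / lam * KK L (p / lam)) * ((p - 1) / lam * KK L ((p - 1) / lam)) /
        ((2 * L - p / lam) * (2 * L + (p - 1) / lam)) := by
  have ha : ∀ k : ℤ, p / lam ≠ k := fun k hk => (h k).1 (by rw [← hk]; field_simp)
  have hb : ∀ k : ℤ, (p - 1) / lam ≠ k := fun k hk => (h k).2 (by rw [← hk]; field_simp)
  have hF : ∀ l, Fct lam p l = 
    (((2 * (l : ℂ) - 2) - p / lam) * (2 * l + p / lam) *
    ((2 * (l : ℂ) - 2) + (p - 1) / lam) * (2 * l - (p - 1) / lam)) /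
    ((((2 * (l : ℂ) - 1)) ^ 2 - (p / lam) ^ 2) * (((2 * (l : ℂ) - 1)) ^ 2 - ((p - 1) / lam) ^ 2)) := by
    intro l
    have ep : p = p / lam * lam := by field_simp
    have eq : p - 1 = (p - 1) / lam * lam := by field_simp
    unfold Fct
    rw [eq]
    generalize (p - 1) / lam = b at *
    rw [ep]
    have e2 : p / lam * lam / lam = p / lam := by field_simp
    have e3 : b * lam / lam = b := by field_simp
    rw [e2, e3]
    generalize p / lam = a at *
    rw [← mul_div_mul_right ((2 * (l : ℂ) - 2 - a) * _ * _ * _) _ (pow_ne_zero 4 hlam)]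
    congr 1 <;> ring
  simp only [hF]
  generalize (p - 1) / lam = b at *
  generalize p / lam = a at *
  induction L with
  | zero => 
    have := ha 0
    have := hb 0
    simp [KK] at *
    field_simp
  | succ L ih =>
    rw [Finset.prod_Icc_succ_top (by omega), ih]
    have e1 : ∀ a, KK (L + 1) a = KK L a *
        (((2 * (L : ℂ) + 2) ^ 2 - a ^ 2) / ((2 * (L : ℂ) + 1) ^ 2 - a ^ 2)) := by
      intro a
      rw [KK, KK, Finset.prod_range_succ]
    have n1 : 2 * (L : ℂ) - a ≠ 0 := fun h => ha (2 * L) (by push_cast; linear_combination -h)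
    have n2 : 2 * (L : ℂ) + b ≠ 0 := fun h => hb (-(2 * L)) (by push_cast; linear_combination h)
    have n3 : 2 * ((L : ℂ) + 1) - a ≠ 0 := fun h => ha (2 * L + 2) (by push_cast; linear_combination -h)
    have n4 : 2 * ((L : ℂ) + 1) + b ≠ 0 := fun h => hb (-(2 * L + 2)) (by push_cast; linear_combination h)
    have n5 : ∀ a : ℂ, (∀ k : ℤ, a ≠ k) → (2 * (L : ℂ) + 1) ^ 2 - a ^ 2 ≠ 0 := by
      intro a ha
      rw [show (2 * (L : ℂ) + 1) ^ 2 - a ^ 2 = (2 * L + 1 - a) * (2 * L + 1 + a) by ring]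
      refine mul_ne_zero (fun h => ha (2 * L + 1) ?_) (fun h => ha (-(2 * L + 1)) ?_)
      · push_cast; linear_combination -h
      · push_cast; linear_combination h
    have n6 := n5 a ha
    have n7 := n5 b hb
    rw [e1, e1]
    push_cast
    rw [show 2 * ((L : ℂ) + 1) - 1 = 2 * L + 1 by ring, show 2 * ((L : ℂ) + 1) - 2 = 2 * L by ring]
    rw [show (2 * (L : ℂ) + 2) ^ 2 - a ^ 2 = (2 * ((L : ℂ) + 1) - a) * (2 * ((L : ℂ) + 1) + a) by ring,
      show (2 * (L : ℂ) + 2) ^ 2 - b ^ 2 = (2 * ((L : ℂ) + 1) + b) * (2 * ((L : ℂ) + 1) - b) by ring]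
    field_simp

noncomputable def TT (lam : ℝ) (p : ℂ) : ℂ :=
  -(Complex.tan (Real.pi * (p / lam) / 2) * Complex.tan (Real.pi * ((p - 1) / lam) / 2))

lemma lin_tendsto (c : ℂ) : Tendsto (fun L : ℕ => (2 * (L : ℂ) + 1) / (2 * L + c)) atTop (𝓝 1) := by
  have := tendsto_add_mul_div_add_mul_atTop_nhds (𝕜 := ℂ) 1 c 2 (d := 2) (by norm_num)
  simpa [add_comm] using this

lemma Fct_tendsto {lam : ℝ} (hlam : (lam : ℂ) ≠ 0) {p : ℂ} 
    (h : ∀ k : ℤ, p ≠ k * lam ∧ p - 1 ≠ k * lam) :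
    Tendsto (fun L => ∏ l ∈ Finset.Icc 1 L, Fct lam p l) atTop (𝓝 (TT lam p)) := by
  have ha : ∀ k : ℤ, p / lam ≠ k := fun k hk => (h k).1 (by rw [← hk]; field_simp)
  have hb : ∀ k : ℤ, (p - 1) / lam ≠ k := fun k hk => (h k).2 (by rw [← hk]; field_simp)
  have t := ((((KK_tendsto _ ha).mul (KK_tendsto _ hb)).neg).mul
    (lin_tendsto (-(p / lam)))).mul (lin_tendsto ((p - 1) / lam))
  rw [mul_one, mul_one] at t
  refine t.congr fun L => ?_
  rw [Fct_prod hlam h]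
  have n1 : (2 * (L : ℂ) + 1) ≠ 0 := by exact_mod_cast (by omega : 2 * L + 1 ≠ 0)
  generalize KK L _ = k1
  generalize KK L _ = k2
  rw [← sub_eq_add_neg]
  generalize p / (lam : ℂ) = a at *
  generalize (p - 1) / (lam : ℂ) = b at *
  field_simp

noncomputable def QQ (lam : ℝ) (p : ℂ) (L : ℕ) : ℂ := ∏ l ∈ Finset.Icc 1 L, rhoB lam p l

lemma QQ_tendsto {lam : ℝ} (hlam : (lam : ℂ) ≠ 0) {p A : ℂ} (n : ℕ)
    (hn : GP lam (-p)) (hp : GP lam (p - n)) (hA : Tendsto (QQ lam p) atTop (𝓝 A)) :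
    Tendsto (QQ lam (p - n)) atTop (𝓝 (A * ∏ x ∈ Finset.range n, TT lam (p - x))) := by
  induction n with
  | zero => simpa using hA
  | succ n ih =>
    have h1 : GP lam (-(p - n)) := by
      have := GP_add hn n
      rwa [show -(p - (n : ℂ)) = -p + n by ring]
    have e : p - ((n + 1 : ℕ) : ℂ) = p - n - 1 := by push_cast; ring
    rw [e] at hp ⊢
    have h2 : GP lam (p - n) := by simpa using GP_succ hp
    have t := (ih h2).mul (Fct_tendsto hlam (ne_int h1 hp))
    rw [Finset.prod_range_succ, ← mul_assoc]
    refine t.congr fun L => ?_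
    unfold QQ
    rw [← Finset.prod_mul_distrib]
    exact Finset.prod_congr rfl fun l hl => (rhoB_step h1 hp l (Finset.mem_Icc.1 hl).1).symm

lemma aPartial_good {lam : ℝ} {u A : ℂ} (h : Tendsto (aPartial lam u) atTop (𝓝 A)) (hA : A ≠ 0) :
    GP lam (-(lam * u / Real.pi)) ∧ GP lam (lam * u / Real.pi) ∧
      Tendsto (QQ lam (lam * u / Real.pi)) atTop (𝓝 (-A)) := by
  have hblk : ∀ l, rhoBlock lam u l = rhoB lam (lam * u / Real.pi) l := fun l => rfl
  have hs : Complex.sin ((lam : ℂ) * (u - (Real.pi : ℂ))) ≠ 0 := by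
    intro hs
    apply hA
    refine tendsto_nhds_unique h ?_
    have : aPartial lam u = fun _ => 0 := by
      funext L
      simp [aPartial, hs]
    rw [this]; exact tendsto_const_nhds
  have hQ : ∀ L, -aPartial lam u L = QQ lam (lam * u / Real.pi) L := by
    intro L
    unfold aPartial QQ
    rw [show (lam : ℂ) * ((Real.pi : ℂ) - u) = -((lam : ℂ) * (u - (Real.pi : ℂ))) by ring,
      Complex.sin_neg]
    simp only [hblk]
    field_simp
  have hT : Tendsto (QQ lam (lam * u / Real.pi)) atTop (𝓝 (-A)) := h.neg.congr hQ
  have hne : ∀ l, 1 ≤ l → rhoB lam (lam * u / Real.pi) l ≠ 0 := by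
    intro l hl h0
    apply hA
    rw [← neg_eq_zero]
    refine tendsto_nhds_unique hT ?_
    refine tendsto_const_nhds.congr' ?_
    filter_upwards [eventually_ge_atTop l] with L hL
    exact (Finset.prod_eq_zero (Finset.mem_Icc.2 ⟨hl, hL⟩) h0).symm
  refine ⟨fun l hl => ?_, fun l hl => ?_, hT⟩
  · have := hne l hl
    simp only [rhoB, ne_eq, div_eq_zero_iff, mul_eq_zero, not_or] at this
    simp only [← sub_eq_add_neg]
    tauto
  · have := hne l hl
    simp only [rhoB, ne_eq, div_eq_zero_iff, mul_eq_zero, not_or] at this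
    tauto

lemma blk_ratio (y : ℝ) (u : ℂ) : blk y u / blk (y + 1) u =
    -(Complex.tan ((u + (Real.pi * y : ℝ)) / 2) / Complex.tan ((u - (Real.pi * y : ℝ)) / 2)) := by
  unfold blk
  have e1 : (u + (Real.pi * (y + 1) : ℝ)) / 2 = (u + (Real.pi * y : ℝ)) / 2 + Real.pi / 2 := by
    push_cast; ring
  have e2 : (u - (Real.pi * (y + 1) : ℝ)) / 2 = (u - (Real.pi * y : ℝ)) / 2 - Real.pi / 2 := by
    push_cast; ring
  rw [e1, e2, Complex.sin_add_pi_div_two, Complex.sin_sub_pi_div_two, Complex.tan, Complex.tan]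
  simp only [div_eq_mul_inv, mul_inv, inv_inv, inv_neg]
  ring

/-- For every `n ≥ 1` and every complex `u` at which all the infinite products defining
`a(u+ν_n)`, `a(u−ν_n)`, `a(u+ν_0)`, `a(u−ν_0)` converge to nonzero values, one has
`a(u+ν_n) a(u−ν_n) / (a(u+ν_0) a(u−ν_0)) = a^1_n(u)`. -/
theorem stmt3 (lam ξ : ℝ) (hlam : 1 < lam) (hxi0 : 0 < ξ)
    (hxi1 : ξ < Real.pi * (lam + 1) / 2) (n : ℕ) (hn : 1 ≤ n) (u : ℂ)
    (Apn Amn Ap0 Am0 : ℂ)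
    (hApn : Tendsto (aPartial lam (u + (nuP lam ξ n : ℝ))) atTop (𝓝 Apn))
    (hApn0 : Apn ≠ 0)
    (hAmn : Tendsto (aPartial lam (u - (nuP lam ξ n : ℝ))) atTop (𝓝 Amn))
    (hAmn0 : Amn ≠ 0)
    (hAp0 : Tendsto (aPartial lam (u + (nuP lam ξ 0 : ℝ))) atTop (𝓝 Ap0))
    (hAp00 : Ap0 ≠ 0)
    (hAm0 : Tendsto (aPartial lam (u - (nuP lam ξ 0 : ℝ))) atTop (𝓝 Am0))
    (hAm00 : Am0 ≠ 0) :
    Apn * Amn / (Ap0 * Am0) = a1 lam ξ n u := by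
  have hl : (lam : ℂ) ≠ 0 := by exact_mod_cast (by linarith : lam ≠ 0)
  have hlr : lam ≠ 0 := by linarith
  have hpi : (Real.pi : ℂ) ≠ 0 := by exact_mod_cast Real.pi_ne_zero
  obtain ⟨_, gp1, t1⟩ := aPartial_good hApn hApn0
  obtain ⟨gm2, _, t2⟩ := aPartial_good hAmn hAmn0
  obtain ⟨gm3, _, t3⟩ := aPartial_good hAp0 hAp00
  obtain ⟨_, gp4, t4⟩ := aPartial_good hAm0 hAm00
  have e1 : (lam : ℂ) * (u + (nuP lam ξ n : ℝ)) / Real.pi =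
      lam * (u + (nuP lam ξ 0 : ℝ)) / Real.pi - n := by
    simp only [nuP]; push_cast; field_simp; ring
  have e2 : (lam : ℂ) * (u - (nuP lam ξ 0 : ℝ)) / Real.pi =
      lam * (u - (nuP lam ξ n : ℝ)) / Real.pi - n := by
    simp only [nuP]; push_cast; field_simp; ring
  rw [e1] at gp1 t1
  rw [e2] at gp4 t4
  have r1 := tendsto_nhds_unique t1 (QQ_tendsto hl n gm3 gp1 t3)
  have r2 := tendsto_nhds_unique t4 (QQ_tendsto hl n gm2 gp4 t2)
  rw [← Finset.prod_range_reflect] at r2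
  set P1 := ∏ x ∈ Finset.range n, TT lam (lam * (u + (nuP lam ξ 0 : ℝ)) / Real.pi - x) with hP1
  set P2 := ∏ j ∈ Finset.range n,
    TT lam (lam * (u - (nuP lam ξ n : ℝ)) / Real.pi - ((n - 1 - j : ℕ) : ℂ)) with hP2
  have hP20 : P2 ≠ 0 := by
    intro h
    rw [h] at r2
    simp at r2
    exact hAm00 r2
  have hLHS : Apn * Amn / (Ap0 * Am0) = P1 / P2 := by
    have r1' : Apn = Ap0 * P1 := by linear_combination -r1
    have r2' : Am0 = Amn * P2 := by linear_combination -r2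
    rw [r1', r2']
    field_simp
  have hre : ∀ f : ℕ → ℂ, ∏ x ∈ Finset.Icc 1 n, f x = ∏ j ∈ Finset.range n, f (j + 1) := by
    intro f
    clear * -
    induction n with
    | zero => simp
    | succ n ih => rw [Finset.prod_Icc_succ_top (by omega), ih, Finset.prod_range_succ]
  rw [hLHS, hP1, hP2, ← Finset.prod_div_distrib, a1, hre]
  refine Finset.prod_congr rfl fun j hj => ?_
  have hj' : j + 1 ≤ n := Finset.mem_range.1 hj
  have hc : ((n - 1 - j : ℕ) : ℂ) = n - 1 - j := by
    rw [Nat.sub_sub, Nat.cast_sub (by omega)]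
    push_cast; ring
  rw [mul_div_mul_comm, blk_ratio, blk_ratio, hc]
  unfold TT
  have f1 : (Real.pi : ℂ) * ((lam * (u + (nuP lam ξ 0 : ℝ)) / Real.pi - j) / lam) / 2 =
      (u + (Real.pi * (ξ / (lam * Real.pi) + 1 / (2 * lam) - ((j + 1 : ℕ) : ℝ) / lam) : ℝ)) / 2 := by
    simp only [nuP]; push_cast; field_simp; ring
  have f2 : (Real.pi : ℂ) * ((lam * (u + (nuP lam ξ 0 : ℝ)) / Real.pi - j - 1) / lam) / 2 =
      (u + (Real.pi * (ξ / (lam * Real.pi) - 1 / (2 * lam) - ((j + 1 : ℕ) : ℝ) / lam) : ℝ)) / 2 := by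
    simp only [nuP]; push_cast; field_simp; ring
  have f3 : (Real.pi : ℂ) * ((lam * (u - (nuP lam ξ n : ℝ)) / Real.pi - (n - 1 - j)) / lam) / 2 =
      (u - (Real.pi * (ξ / (lam * Real.pi) - 1 / (2 * lam) - ((j + 1 : ℕ) : ℝ) / lam) : ℝ)) / 2 := by
    simp only [nuP]; push_cast; field_simp; ring
  have f4 : (Real.pi : ℂ) * ((lam * (u - (nuP lam ξ n : ℝ)) / Real.pi - (n - 1 - j) - 1) / lam) / 2 =
      (u - (Real.pi * (ξ / (lam * Real.pi) + 1 / (2 * lam) - ((j + 1 : ℕ) : ℝ) / lam) : ℝ)) / 2 := by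
    simp only [nuP]; push_cast; field_simp; ring
  rw [f1, f2, f3, f4, neg_div_neg_eq, neg_mul_neg, div_mul_div_comm]
  congr 1
  ring
end

section
/- For every integer n ≥ 0 the boundary-bootstrap identity P^-(u) · b(u−ν_n) · b(u+ν_n) + P^+(u) · c(u−ν_n) · c(u+ν_n) = \bar{P^+}(u) · a^1_n(u) holds at every complex u at which all the infinite products involved converge to nonzero values. -/
open Complex Real Filter Topology

/-- The `k`-th factor of the infinite Gamma product defining `R_0(u)`. -/
noncomputable def r0Block (lam : ℝ) (u : ℂ) (k : ℕ) : ℂ :=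
  (Complex.Gamma (1 + (lam : ℂ) * (4 * (k : ℂ) - 4) - 2 * (lam : ℂ) * u / (Real.pi : ℂ)) *
   Complex.Gamma (4 * (lam : ℂ) * (k : ℂ) - 2 * (lam : ℂ) * u / (Real.pi : ℂ)) *
   Complex.Gamma ((lam : ℂ) * (4 * (k : ℂ) - 3) + 2 * (lam : ℂ) * u / (Real.pi : ℂ)) *
   Complex.Gamma (1 + (lam : ℂ) * (4 * (k : ℂ) - 1) + 2 * (lam : ℂ) * u / (Real.pi : ℂ))) /
  (Complex.Gamma ((lam : ℂ) * (4 * (k : ℂ) - 3) - 2 * (lam : ℂ) * u / (Real.pi : ℂ)) *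
   Complex.Gamma (1 + (lam : ℂ) * (4 * (k : ℂ) - 1) - 2 * (lam : ℂ) * u / (Real.pi : ℂ)) *
   Complex.Gamma (1 + (lam : ℂ) * (4 * (k : ℂ) - 4) + 2 * (lam : ℂ) * u / (Real.pi : ℂ)) *
   Complex.Gamma (4 * (lam : ℂ) * (k : ℂ) + 2 * (lam : ℂ) * u / (Real.pi : ℂ)))

/-- The `K`-th partial product defining `R_0(u)`. -/
noncomputable def r0Partial (lam : ℝ) (u : ℂ) (K : ℕ) : ℂ :=
  ∏ k ∈ Finset.Icc 1 K, r0Block lam u k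

/-- The `l`-th factor of the infinite Gamma product defining the `ξ`-dependent part
`G^+(u)` of `P^+(u) = R_0(u) G^+(u)`; `G^-` is obtained by `ξ ↦ −ξ`. -/
noncomputable def gBlock (lam ξ : ℝ) (u : ℂ) (l : ℕ) : ℂ :=
  (Complex.Gamma (1/2 + 2 * (l : ℂ) * (lam : ℂ) + (ξ : ℂ) / (Real.pi : ℂ) + (lam : ℂ) * u / (Real.pi : ℂ)) *
   Complex.Gamma (1/2 + (2 * (l : ℂ) - 2) * (lam : ℂ) - (ξ : ℂ) / (Real.pi : ℂ) + (lam : ℂ) * u / (Real.pi : ℂ)) *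
   Complex.Gamma (1/2 + (2 * (l : ℂ) - 1) * (lam : ℂ) + (ξ : ℂ) / (Real.pi : ℂ) - (lam : ℂ) * u / (Real.pi : ℂ)) *
   Complex.Gamma (1/2 + (2 * (l : ℂ) - 1) * (lam : ℂ) - (ξ : ℂ) / (Real.pi : ℂ) - (lam : ℂ) * u / (Real.pi : ℂ))) /
  (Complex.Gamma (1/2 + (2 * (l : ℂ) - 1) * (lam : ℂ) + (ξ : ℂ) / (Real.pi : ℂ) + (lam : ℂ) * u / (Real.pi : ℂ)) *
   Complex.Gamma (1/2 + (2 * (l : ℂ) - 1) * (lam : ℂ) - (ξ : ℂ) / (Real.pi : ℂ) + (lam : ℂ) * u / (Real.pi : ℂ)) *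
   Complex.Gamma (1/2 + 2 * (l : ℂ) * (lam : ℂ) + (ξ : ℂ) / (Real.pi : ℂ) - (lam : ℂ) * u / (Real.pi : ℂ)) *
   Complex.Gamma (1/2 + (2 * (l : ℂ) - 2) * (lam : ℂ) - (ξ : ℂ) / (Real.pi : ℂ) - (lam : ℂ) * u / (Real.pi : ℂ)))

/-- The `L`-th partial product defining `G^+(u)` (and `G^-(u) = G^+(u)|_{ξ→−ξ}`). -/
noncomputable def gPartial (lam ξ : ℝ) (u : ℂ) (L : ℕ) : ℂ :=
  ∏ l ∈ Finset.Icc 1 L, gBlock lam ξ u l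

/-- The `L`-th partial product defining `b(u) = sin(λu) ρ(u)`. -/
noncomputable def bPartial (lam : ℝ) (u : ℂ) (L : ℕ) : ℂ :=
  Complex.sin ((lam : ℂ) * u) *
    ((1 / Complex.sin ((lam : ℂ) * (u - (Real.pi : ℂ)))) *
      ∏ l ∈ Finset.Icc 1 L, rhoBlock lam u l)

/-- The `L`-th partial product defining `c(u) = sin(λπ) ρ(u)`. -/
noncomputable def cPartial (lam : ℝ) (u : ℂ) (L : ℕ) : ℂ :=
  Complex.sin ((lam : ℂ) * (Real.pi : ℂ)) *
    ((1 / Complex.sin ((lam : ℂ) * (u - (Real.pi : ℂ)))) *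
      ∏ l ∈ Finset.Icc 1 L, rhoBlock lam u l)


lemma aux_prod_Icc (f : ℕ → ℂ) (L : ℕ) :
    ∏ l ∈ Finset.Icc 1 L, f l = ∏ i ∈ Finset.range L, f (i + 1) := by
  induction L with
  | zero => simp
  | succ k ih => rw [Finset.prod_Icc_succ_top (by omega), Finset.prod_range_succ, ih]

lemma aux_sum_tele (c : ℝ) (hc : 1 < c) (n : ℕ) :
    ∑ j ∈ Finset.range n, 1 / ((c + j) * (c + j)) ≤ 1 / (c - 1) - 1 / (c - 1 + n) := by
  induction n with
  | zero => simp
  | succ k ih =>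
    rw [Finset.sum_range_succ]
    have hk : (0:ℝ) ≤ k := Nat.cast_nonneg k
    have h1 : 0 < c - 1 + k := by linarith
    have h2 : 0 < c + k := by linarith
    have : 1 / ((c + k) * (c + k)) ≤ 1 / (c - 1 + k) - 1 / (c - 1 + (k + 1 : ℕ)) := by
      push_cast
      have e : c - 1 + ((k:ℝ) + 1) = c + k := by ring
      rw [e, div_sub_div _ _ h1.ne' h2.ne', div_le_div_iff₀ (by positivity) (by positivity)]
      nlinarith [mul_pos h1 h2]
    linarith

lemma aux_gamma_ratio_bound (w1 w2 w3 w4 : ℂ) (c : ℝ) (hc : 1 < c)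
    (h1 : c ≤ w1.re) (h2 : c ≤ w2.re) (h3 : c ≤ w3.re) (h4 : c ≤ w4.re)
    (hs : w1 + w2 = w3 + w4) :
    ‖Gamma w1 * Gamma w2 / (Gamma w3 * Gamma w4) - 1‖
      ≤ Real.exp (‖w3 * w4 - w1 * w2‖ / (c - 1)) - 1 := by
  have key : ∀ w : ℂ, c ≤ w.re → ∀ j : ℕ, c + j ≤ ‖w + j‖ := by
    intro w hw j
    calc c + j ≤ (w + j).re := by simpa using hw
      _ ≤ ‖w + j‖ := Complex.re_le_norm _
  have key0 : ∀ w : ℂ, c ≤ w.re → ∀ j : ℕ, w + j ≠ 0 := by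
    intro w hw j h0
    have := key w hw j
    rw [h0, norm_zero] at this
    have : (0:ℝ) ≤ j := Nat.cast_nonneg j
    linarith
  have g0 : ∀ w : ℂ, c ≤ w.re → Gamma w ≠ 0 := fun w hw =>
    Complex.Gamma_ne_zero_of_re_pos (by linarith)
  have lim : Tendsto (fun n => GammaSeq w1 n * GammaSeq w2 n / (GammaSeq w3 n * GammaSeq w4 n))
      atTop (𝓝 (Gamma w1 * Gamma w2 / (Gamma w3 * Gamma w4))) :=
    ((GammaSeq_tendsto_Gamma w1).mul (GammaSeq_tendsto_Gamma w2)).div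
      ((GammaSeq_tendsto_Gamma w3).mul (GammaSeq_tendsto_Gamma w4)) (mul_ne_zero (g0 _ h3) (g0 _ h4))
  refine le_of_tendsto (lim.sub_const 1).norm ?_
  filter_upwards [eventually_gt_atTop 0] with n hn
  have hn' : (n : ℂ) ≠ 0 := by exact_mod_cast hn.ne'
  have e : GammaSeq w1 n * GammaSeq w2 n / (GammaSeq w3 n * GammaSeq w4 n)
      = ∏ j ∈ Finset.range (n+1), (1 + (w3 * w4 - w1 * w2) / ((w1 + j) * (w2 + j))) := by
    have : ∀ j ∈ Finset.range (n+1), (1 + (w3 * w4 - w1 * w2) / ((w1 + j) * (w2 + j)))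
        = ((w3 + j) * (w4 + j)) / ((w1 + j) * (w2 + j)) := by
      intro j _
      have a := key0 w1 h1 j
      have b := key0 w2 h2 j
      field_simp
      linear_combination (j:ℂ) * hs
    rw [Finset.prod_congr rfl this, Finset.prod_div_distrib, Finset.prod_mul_distrib,
      Finset.prod_mul_distrib]
    have p : ∀ w : ℂ, c ≤ w.re → ∏ j ∈ Finset.range (n+1), (w + j) ≠ 0 := fun w hw =>
      Finset.prod_ne_zero_iff.2 (fun j _ => key0 w hw j)
    have p1 := p _ h1
    have p2 := p _ h2
    have p3 := p _ h3
    have p4 := p _ h4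
    have hf : ((n.factorial : ℕ) : ℂ) ≠ 0 := by exact_mod_cast n.factorial_ne_zero
    have hp : (n:ℂ) ^ w1 * (n:ℂ) ^ w2 = (n:ℂ) ^ w3 * (n:ℂ) ^ w4 := by
      rw [← Complex.cpow_add _ _ hn', ← Complex.cpow_add _ _ hn', hs]
    have q3 : (n:ℂ) ^ w3 ≠ 0 := by simp [Complex.cpow_eq_zero_iff, hn']
    have q4 : (n:ℂ) ^ w4 ≠ 0 := by simp [Complex.cpow_eq_zero_iff, hn']
    simp only [Complex.GammaSeq]
    field_simp
    linear_combination hp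
  rw [e]
  refine (Finset.norm_prod_one_add_sub_one_le _ _).trans ?_
  gcongr
  set C := ‖w3 * w4 - w1 * w2‖
  have hC : 0 ≤ C := norm_nonneg _
  calc ∑ j ∈ Finset.range (n+1), ‖(w3 * w4 - w1 * w2) / ((w1 + j) * (w2 + j))‖
      ≤ ∑ j ∈ Finset.range (n+1), C * (1 / ((c + j) * (c + j))) := by
        refine Finset.sum_le_sum fun j _ => ?_
        rw [norm_div, norm_mul, mul_one_div]
        have := key w1 h1 j
        have := key w2 h2 j
        have : (0:ℝ) ≤ j := Nat.cast_nonneg j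
        have : 0 < c + j := by linarith
        gcongr
    _ = C * ∑ j ∈ Finset.range (n+1), (1 / ((c + j) * (c + j))) := by rw [Finset.mul_sum]
    _ ≤ C * (1 / (c - 1)) := by
        gcongr
        refine (aux_sum_tele c hc _).trans ?_
        have : 0 ≤ 1 / (c - 1 + ((n+1:ℕ):ℝ)) := by
          have : (0:ℝ) ≤ ((n+1:ℕ):ℝ) := Nat.cast_nonneg _
          apply div_nonneg <;> linarith
        linarith
    _ = C / (c - 1) := by ring

noncomputable def gg (s A : ℂ) : ℂ := Gamma (A + s) / Gamma (A - s)
noncomputable def phi (s A : ℂ) : ℂ := (A + s) / (A - s)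

lemma gg_ratio_tendsto (s a b : ℂ) (d : ℝ) (hd : 0 < d) :
    Tendsto (fun L : ℕ => gg s (a + d * L) / gg s (b + d * L)) atTop (𝓝 1) := by
  set c0 : ℝ := min a.re b.re - |s.re| with hc0
  have hlin : Tendsto (fun L : ℕ => c0 + d * L) atTop atTop :=
    tendsto_atTop_add_const_left _ _ (Tendsto.const_mul_atTop hd tendsto_natCast_atTop_atTop)
  have hb : Tendsto (fun L : ℕ => Real.exp (‖2 * s * (a - b)‖ / (c0 + d * L - 1)) - 1) atTop (𝓝 0) := by
    have h1 : Tendsto (fun L : ℕ => ‖2 * s * (a - b)‖ / (c0 + d * L - 1)) atTop (𝓝 0) :=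
      Tendsto.const_div_atTop (tendsto_atTop_add_const_right _ (-1) hlin) _
    have := ((Real.continuous_exp.tendsto 0).comp h1).sub_const 1
    simpa using this
  rw [tendsto_iff_norm_sub_tendsto_zero]
  refine squeeze_zero' (Eventually.of_forall fun _ => norm_nonneg _) ?_ hb
  filter_upwards [hlin.eventually_gt_atTop 1] with L hL
  have ha1 : c0 ≤ a.re - |s.re| := by rw [hc0]; linarith [min_le_left a.re b.re]
  have hb1 : c0 ≤ b.re - |s.re| := by rw [hc0]; linarith [min_le_right a.re b.re]
  have s1 := le_abs_self s.re
  have s2 := neg_abs_le s.re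
  have := aux_gamma_ratio_bound (a + d * L + s) (b + d * L - s) (a + d * L - s) (b + d * L + s)
    (c0 + d * L) hL (by simp; linarith) (by simp; linarith) (by simp; linarith)
    (by simp; linarith) (by ring)
  have e : gg s (a + d * L) / gg s (b + d * L) = Gamma (a + d * L + s) * Gamma (b + d * L - s) /
      (Gamma (a + d * L - s) * Gamma (b + d * L + s)) := by
    simp only [gg]; rw [div_div_div_eq]
  rw [e]
  refine this.trans_eq ?_
  congr 4
  ring

noncomputable def EE (z : ℂ) (L : ℕ) : ℂ := ∏ k ∈ Finset.range L, (((k:ℂ) + z) * (k + 1 - z))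

lemma EE_euler (z : ℂ) (L : ℕ) : 
    EE z L * (L + z) = (L.factorial : ℂ)^2 * (z * ∏ j ∈ Finset.range L, (1 - z^2 / ((j:ℂ)+1)^2)) := by
  induction L with
  | zero => simp [EE]
  | succ k ih =>
    have h : ((k:ℂ)+1) ≠ 0 := by exact_mod_cast k.succ_ne_zero
    have e : EE z (k+1) = EE z k * (((k:ℂ) + z) * (k + 1 - z)) := by
      simp [EE, Finset.prod_range_succ]
    rw [e, Finset.prod_range_succ, Nat.factorial_succ]
    push_cast
    have : (1 - z^2 / ((k:ℂ)+1)^2) * ((k:ℂ)+1)^2 = (k+1-z)*(k+1+z) := by field_simp; ring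
    linear_combination ((k:ℂ) + 1 - z) * (k+1+z) * ih - (k.factorial : ℂ)^2 * (z * ∏ j ∈ Finset.range k, (1 - z^2 / ((j:ℂ)+1)^2)) * this

lemma EE_tendsto (z : ℂ) :
    Tendsto (fun L : ℕ => EE z L * (π * L / (L.factorial : ℂ)^2)) atTop (𝓝 (Complex.sin (π * z))) := by
  have h1 := Complex.tendsto_euler_sin_prod z
  have h2 : Tendsto (fun L : ℕ => (L : ℂ) / (L + z)) atTop (𝓝 1) := tendsto_natCast_div_add_atTop z
  have h3 := h1.mul h2
  rw [mul_one] at h3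
  refine h3.congr' ?_
  have h4 : ∀ᶠ L : ℕ in atTop, (L:ℂ) + z ≠ 0 := by
    filter_upwards [h2.eventually_ne one_ne_zero] with L hL h0
    rw [h0] at hL; simp at hL
  filter_upwards [h4] with L hL
  have hf : ((L.factorial : ℕ) : ℂ) ≠ 0 := by exact_mod_cast L.factorial_ne_zero
  have := EE_euler z L
  generalize (∏ j ∈ Finset.range L, (1 - z^2 / ((j:ℂ)+1)^2)) = Q at this ⊢
  field_simp
  linear_combination (-(L:ℂ)) * this

lemma EE_ratio (z w : ℂ) (hw : Complex.sin (π * w) ≠ 0) :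
    Tendsto (fun L : ℕ => EE z L / EE w L) atTop (𝓝 (Complex.sin (π * z) / Complex.sin (π * w))) := by
  refine ((EE_tendsto z).div (EE_tendsto w) hw).congr' ?_
  filter_upwards [eventually_gt_atTop 0] with L hL
  have hf : ((L.factorial : ℕ) : ℂ) ≠ 0 := by exact_mod_cast L.factorial_ne_zero
  have hL' : (L : ℂ) ≠ 0 := by exact_mod_cast hL.ne'
  have hp : (π : ℂ) ≠ 0 := by exact_mod_cast Real.pi_ne_zero
  exact mul_div_mul_right _ _ (by positivity)

lemma gg_ne (s A : ℂ) (h : gg s A ≠ 0) (k : ℕ) : A + s ≠ -k ∧ A - s ≠ -k := by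
  constructor <;> intro h0 <;> apply h <;> simp [gg, h0, Complex.Gamma_neg_nat_eq_zero]

lemma gg_ne_of (s A : ℂ) (h : ∀ k : ℕ, A + s ≠ -k ∧ A - s ≠ -k) : gg s A ≠ 0 :=
  div_ne_zero (Complex.Gamma_ne_zero fun k => (h k).1) (Complex.Gamma_ne_zero fun k => (h k).2)

lemma gg_step (s A : ℂ) (h : gg s A ≠ 0) :
    gg s (A + 1) = gg s A * phi s A ∧ gg s (A+1) ≠ 0 := by
  have h0 := gg_ne s A h 0
  simp only [Nat.cast_zero, neg_zero] at h0
  have e : gg s (A + 1) = gg s A * phi s A := by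
    unfold gg phi
    rw [show A + 1 + s = (A + s) + 1 by ring, show A + 1 - s = (A - s) + 1 by ring,
      Complex.Gamma_add_one _ h0.1, Complex.Gamma_add_one _ h0.2, mul_div_mul_comm, mul_comm]
  refine ⟨e, ?_⟩
  rw [e]
  exact mul_ne_zero h (div_ne_zero h0.1 h0.2)

lemma gg_up (s B : ℂ) (h : gg s B ≠ 0) (n : ℕ) :
    gg s (B + n) = gg s B * ∏ k ∈ Finset.range n, phi s (B + k) ∧ gg s (B + n) ≠ 0 := by
  induction n with
  | zero => simpa using h
  | succ k ih =>
    have := gg_step s (B + k) ih.2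
    push_cast
    rw [← add_assoc]
    refine ⟨?_, this.2⟩
    rw [this.1, ih.1, Finset.prod_range_succ]; ring

lemma gg_down (s A : ℂ) (n : ℕ) (h : gg s (A - n) ≠ 0) :
    gg s A = gg s (A - n) * ∏ k ∈ Finset.range n, phi s (A - (k + 1)) ∧ gg s A ≠ 0 := by
  induction n with
  | zero => simpa using h
  | succ k ih =>
    have h1 := gg_step s _ h
    rw [show A - ((k+1 : ℕ):ℂ) + 1 = A - k by push_cast; ring] at h1
    have h2 := ih h1.2
    refine ⟨?_, h2.2⟩
    rw [h2.1, Finset.prod_range_succ, h1.1]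
    push_cast
    ring

lemma gg_refl (s A : ℂ) :
    gg s A / gg s (1 - A) = Complex.sin (π * (A - s)) / Complex.sin (π * (A + s)) := by
  have h1 := Complex.Gamma_mul_Gamma_one_sub (A + s)
  have h2 := Complex.Gamma_mul_Gamma_one_sub (A - s)
  have hp : (π : ℂ) ≠ 0 := by exact_mod_cast Real.pi_ne_zero
  unfold gg
  rw [div_div_div_eq, show 1 - A - s = 1 - (A + s) by ring, show 1 - A + s = 1 - (A - s) by ring,
    h1, h2, div_div_div_cancel_left' _ _ hp]

lemma ne_of_tendsto_prod (f : ℕ → ℂ) (v : ℂ)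
    (h : Tendsto (fun L => ∏ l ∈ Finset.Icc 1 L, f l) atTop (𝓝 v)) (hv : v ≠ 0) (i : ℕ) :
    f (i + 1) ≠ 0 := by
  obtain ⟨L, hL, hL2⟩ := ((h.eventually_ne hv).and (eventually_ge_atTop (i+1))).exists
  rw [Finset.prod_ne_zero_iff] at hL
  exact hL (i+1) (by simp; omega)

lemma tele (f : ℕ → ℂ) (hf : ∀ i, f i ≠ 0) (L : ℕ) :
    ∏ i ∈ Finset.range L, f (i+1) / f i = f L / f 0 := by
  induction L with
  | zero => simp [hf 0]
  | succ k ih =>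
    rw [Finset.prod_range_succ, ih]
    have := hf k
    have := hf 0
    field_simp

lemma gBlock_eq (lam ξ : ℝ) (u s x : ℂ) (hs : s = lam * u / π) (hx : x = ξ / π) (l : ℕ) :
    gBlock lam ξ u l = gg s (1/2 + 2 * l * lam + x) * gg s (1/2 + (2 * l - 2) * lam - x) /
      (gg s (1/2 + (2 * l - 1) * lam + x) * gg s (1/2 + (2 * l - 1) * lam - x)) := by
  unfold gBlock gg
  rw [← hs, ← hx]
  simp only [div_eq_mul_inv, mul_inv, inv_inv]
  ring

lemma rhoBlock_eq (lam : ℝ) (u v s m : ℂ) (hs : s = lam * u / π) (hm : m = lam * v / π) (l : ℕ) :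
    rhoBlock lam (u - v) l * rhoBlock lam (u + v) l =
      (gg s ((2 * l - 1) * lam + m) * gg s ((2 * l - 1) * lam - m) *
       gg s (1 + (2 * l - 1) * lam + m) * gg s (1 + (2 * l - 1) * lam - m)) /
      (gg s ((2 * l - 2) * lam + m) * gg s ((2 * l - 2) * lam - m) *
       gg s (1 + 2 * l * lam + m) * gg s (1 + 2 * l * lam - m)) := by
  unfold rhoBlock gg
  rw [show (lam:ℂ) * (u - v) / π = s - m by rw [hs, hm]; ring,
    show (lam:ℂ) * (u + v) / π = s + m by rw [hs, hm]; ring]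
  simp only [sub_eq_add_neg, neg_add, neg_neg, add_assoc]
  simp only [div_eq_mul_inv, mul_inv, inv_inv]
  simp only [add_comm m, add_comm (-m)]
  ring

/-- even/odd building blocks -/
noncomputable def zp (s lam l p : ℂ) : ℂ :=
  phi s (2 * l * lam + p) * phi s ((2 * l - 1) * lam - p) /
    (phi s ((2 * l - 1) * lam + p) * phi s ((2 * l - 2) * lam - p))

noncomputable def wp (s lam l q : ℂ) : ℂ :=
  phi s ((2 * l + 1) * lam - q) * phi s ((2 * l - 2) * lam + q) /
    (phi s ((2 * l - 3) * lam + q) * phi s (2 * l * lam - q))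

lemma field_core (a1 a2 a3 a4 b1 b2 b3 b4 c1 c2 d1 d2 P1 P2 P3 P4 Q1 Q2 Q3 Q4 x1 x3 y2 y4 : ℂ)
    (ha1 : a1 ≠ 0) (ha3 : a3 ≠ 0) (ha2 : a2 ≠ 0) (ha4 : a4 ≠ 0)
    (hb1 : b1 ≠ 0) (hb2 : b2 ≠ 0) (hb3 : b3 ≠ 0) (hb4 : b4 ≠ 0)
    (hc1 : c1 ≠ 0) (hc2 : c2 ≠ 0)
    (hP1 : P1 ≠ 0) (hP2 : P2 ≠ 0) (hP3 : P3 ≠ 0) (hP4 : P4 ≠ 0)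
    (hQ1 : Q1 ≠ 0) (hQ2 : Q2 ≠ 0) (hQ3 : Q3 ≠ 0) (hQ4 : Q4 ≠ 0)
    (e1 : x1 = a1 * P1) (e3 : x3 = a3 * P3) (e2 : y2 = b2 * Q2) (e4 : y4 = b4 * Q4)
    (hd1 : d1 = a2 * P2) (hd2 : d2 = a4 * P4) :
    a1 * d1 / (a3 * d2) * ((Q1 * Q4 / (Q3 * Q2)) * (P1 * P4 / (P2 * P3))) =
    (b1 * Q1 * b2 / (b3 * Q3 * b4)) * ((c1 * y4 * b3 * c2) / (a4 * y2 * b1 * x3)) *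
      ((x1 * a2) / (c2 * c1)) := by
  subst e1 e3 e2 e4 hd1 hd2
  field_simp

lemma block_id (s m lam l : ℂ) (n : ℕ)
    (a1 : gg s (1 + (2 * l + 1) * lam - m - n) ≠ 0)
    (a2 : gg s ((2 * l - 3) * lam + m) ≠ 0)
    (a3 : gg s (1 + 2 * l * lam - m - n) ≠ 0)
    (a4 : gg s ((2 * l - 2) * lam + m) ≠ 0)
    (b1 : gg s (1 + 2 * l * lam + m) ≠ 0)
    (b2 : gg s ((2 * l - 2) * lam - m - n) ≠ 0)
    (b3 : gg s (1 + (2 * l - 1) * lam + m) ≠ 0)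
    (b4 : gg s ((2 * l - 1) * lam - m - n) ≠ 0)
    (c1 : gg s ((2 * l - 1) * lam + m) ≠ 0)
    (c2 : gg s (1 + (2 * l - 1) * lam - m) ≠ 0) :
    gg s (1 + (2 * l + 1) * lam - m - n) * gg s ((2 * l - 3) * lam + m + n) /
      (gg s (1 + 2 * l * lam - m - n) * gg s ((2 * l - 2) * lam + m + n)) *
      ∏ k ∈ Finset.range n, (zp s lam l (m + k + 1) * wp s lam l (m + k)) =
    (gg s (1 + 2 * l * lam + m + n) * gg s ((2 * l - 2) * lam - m - n) /
      (gg s (1 + (2 * l - 1) * lam + m + n) * gg s ((2 * l - 1) * lam - m - n))) *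
    ((gg s ((2 * l - 1) * lam + m) * gg s ((2 * l - 1) * lam - m) *
       gg s (1 + (2 * l - 1) * lam + m) * gg s (1 + (2 * l - 1) * lam - m)) /
      (gg s ((2 * l - 2) * lam + m) * gg s ((2 * l - 2) * lam - m) *
       gg s (1 + 2 * l * lam + m) * gg s (1 + 2 * l * lam - m))) *
    ((gg s (1 + (2 * l + 1) * lam - m) * gg s ((2 * l - 3) * lam + m)) /
      (gg s (1 + (2 * l - 1) * lam - m) * gg s ((2 * l - 1) * lam + m))) := by
  obtain ⟨A1, A1'⟩ := gg_down s _ n a1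
  obtain ⟨A2, A2'⟩ := gg_up s _ a2 n
  obtain ⟨A3, A3'⟩ := gg_down s _ n a3
  obtain ⟨A4, A4'⟩ := gg_up s _ a4 n
  obtain ⟨B1, B1'⟩ := gg_up s _ b1 n
  obtain ⟨B2, B2'⟩ := gg_down s _ n b2
  obtain ⟨B3, B3'⟩ := gg_up s _ b3 n
  obtain ⟨B4, B4'⟩ := gg_down s _ n b4
  have hprod : ∏ k ∈ Finset.range n, (zp s lam l (m + k + 1) * wp s lam l (m + k)) =
      (((∏ k ∈ Finset.range n, phi s (1 + 2 * l * lam + m + k)) *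
        (∏ k ∈ Finset.range n, phi s ((2 * l - 1) * lam - m - (k+1)))) /
       ((∏ k ∈ Finset.range n, phi s (1 + (2 * l - 1) * lam + m + k)) *
        (∏ k ∈ Finset.range n, phi s ((2 * l - 2) * lam - m - (k+1))))) *
      (((∏ k ∈ Finset.range n, phi s (1 + (2 * l + 1) * lam - m - (k+1))) *
        (∏ k ∈ Finset.range n, phi s ((2 * l - 2) * lam + m + k))) /
       ((∏ k ∈ Finset.range n, phi s ((2 * l - 3) * lam + m + k)) *
        (∏ k ∈ Finset.range n, phi s (1 + 2 * l * lam - m - (k+1))))) := by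
    simp only [← Finset.prod_mul_distrib, ← Finset.prod_div_distrib]
    refine Finset.prod_congr rfl fun k _ => ?_
    unfold zp wp
    congr 1
    · congr 2 <;> congr 1 <;> ring
    · congr 2 <;> congr 1 <;> ring
  rw [hprod, B1, B3]
  have nz : ∀ {x a P : ℂ}, x = a * P → x ≠ 0 → P ≠ 0 := by
    intro x a P h hx h0; apply hx; rw [h, h0, mul_zero]
  exact field_core _ _ _ _ _ _ _ _ _ _ _ _ _ _ _ _ _ _ _ _ _ _ _ _ a1 a3 a2 a4 b1 b2 b3 b4 c1 c2
    (nz A1 A1') (nz A2 A2') (nz A3 A3') (nz A4 A4') (nz B1 B1') (nz B2 B2') (nz B3 B3') (nz B4 B4')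
    A1 A3 B2 B4 A2 A4

lemma phi_scale (s lam A X Y : ℂ) (hl : lam ≠ 0) (h1 : A + s = 2 * lam * X)
    (h2 : A - s = 2 * lam * Y) : phi s A = X / Y := by
  unfold phi
  rw [h1, h2, mul_div_mul_left _ _ (by simpa using hl)]

lemma ratio_shuffle (a b c d e f g h : ℂ) :
    (a / b) * (c / d) / ((e / f) * (g / h)) = ((h * a) / (g * b)) * ((f * c) / (e * d)) := by
  simp only [div_eq_mul_inv, mul_inv, inv_inv]
  ring

lemma ratio_shuffle' (a b c d e f g h : ℂ) :
    (a / b) * (c / d) / ((e / f) * (g / h)) = ((c * h) / (d * g)) * ((f * a) / (e * b)) := by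
  simp only [div_eq_mul_inv, mul_inv, inv_inv]
  ring

lemma zp_prod (s lam p y y' : ℂ) (hl : lam ≠ 0) (hy : p + s = 2 * lam * y)
    (hy' : p - s = 2 * lam * y') (L : ℕ) :
    ∏ i ∈ Finset.range L, zp s lam ((i + 1 : ℕ) : ℂ) p =
      (EE (-y) L / EE (-y') L) * (EE (1/2 + y') L / EE (1/2 + y) L) := by
  unfold EE
  simp only [← Finset.prod_mul_distrib, ← Finset.prod_div_distrib]
  refine Finset.prod_congr rfl fun i _ => ?_
  unfold zp
  rw [phi_scale s lam _ (i + 1 - -y) (i + 1 - -y') hl (by push_cast; linear_combination hy)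
      (by push_cast; linear_combination hy'),
    phi_scale s lam _ (i + 1 - (1/2 + y')) (i + 1 - (1/2 + y)) hl
      (by push_cast; linear_combination -hy') (by push_cast; linear_combination -hy),
    phi_scale s lam _ (i + (1/2 + y)) (i + (1/2 + y')) hl
      (by push_cast; linear_combination hy) (by push_cast; linear_combination hy'),
    phi_scale s lam _ (i + -y') (i + -y) hl
      (by push_cast; linear_combination -hy') (by push_cast; linear_combination -hy)]
  exact ratio_shuffle _ _ _ _ _ _ _ _

lemma wp_prod (s lam p y y' : ℂ) (hl : lam ≠ 0) (hy : p + s = 2 * lam * y)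
    (hy' : p - s = 2 * lam * y') (L : ℕ) :
    ∏ i ∈ Finset.range L, wp s lam ((i + 1 : ℕ) : ℂ) p =
      (EE y L / EE y' L) * (EE (y' - 1/2) L / EE (y - 1/2) L) := by
  unfold EE
  simp only [← Finset.prod_mul_distrib, ← Finset.prod_div_distrib]
  refine Finset.prod_congr rfl fun i _ => ?_
  unfold wp
  rw [phi_scale s lam _ (i + 1 - (y' - 1/2)) (i + 1 - (y - 1/2)) hl
      (by push_cast; linear_combination -hy') (by push_cast; linear_combination -hy),
    phi_scale s lam _ (i + y) (i + y') hl
      (by push_cast; linear_combination hy) (by push_cast; linear_combination hy'),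
    phi_scale s lam _ (i + (y - 1/2)) (i + (y' - 1/2)) hl
      (by push_cast; linear_combination hy) (by push_cast; linear_combination hy'),
    phi_scale s lam _ (i + 1 - y') (i + 1 - y) hl
      (by push_cast; linear_combination -hy') (by push_cast; linear_combination -hy)]
  exact ratio_shuffle' _ _ _ _ _ _ _ _

/-- limit of the even/odd products, in terms of the trigonometric blocks -/
lemma zp_wp_tendsto (lam p : ℝ) (u s : ℂ) (hl : lam ≠ 0) (hs : s = lam * u / π)
    (h : ∀ j : ℤ, (p : ℂ) + j * lam + s ≠ 0 ∧ (p : ℂ) + j * lam - s ≠ 0) :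
    Tendsto (fun L : ℕ => ∏ i ∈ Finset.range L, zp s lam ((i + 1 : ℕ) : ℂ) p) atTop
      (𝓝 (blk (p / lam) u / blk (p / lam + 1) u)) ∧
    Tendsto (fun L : ℕ => ∏ i ∈ Finset.range L, wp s lam ((i + 1 : ℕ) : ℂ) p) atTop
      (𝓝 (blk (p / lam) u / blk (p / lam + 1) u)) := by
  have hl' : (lam : ℂ) ≠ 0 := by exact_mod_cast hl
  have hp : (π : ℂ) ≠ 0 := by exact_mod_cast Real.pi_ne_zero
  set y : ℂ := (p + s) / (2 * lam) with hy0
  set y' : ℂ := (p - s) / (2 * lam) with hy0'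
  have hy : (p:ℂ) + s = 2 * lam * y := by rw [hy0]; field_simp
  have hy' : (p:ℂ) - s = 2 * lam * y' := by rw [hy0']; field_simp
  have hu : u = π * s / lam := by rw [hs]; field_simp
  have n1 : Complex.sin (π * y') ≠ 0 := by
    intro h0
    obtain ⟨k, hk⟩ := Complex.sin_eq_zero_iff.1 h0
    have : y' = k := mul_left_cancel₀ hp (by rw [hk]; ring)
    apply (h (-2 * k)).2
    push_cast
    rw [this] at hy'
    linear_combination hy'
  have n2 : Complex.cos (π * y) ≠ 0 := by
    intro h0
    obtain ⟨k, hk⟩ := Complex.cos_eq_zero_iff.1 h0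
    have : y = (2 * k + 1) / 2 := mul_left_cancel₀ hp (by rw [hk]; ring)
    apply (h (-(2 * k + 1))).1
    push_cast
    rw [this] at hy
    linear_combination hy
  have s1 : ∀ z : ℂ, Complex.sin (π * (1/2 + z)) = Complex.cos (π * z) := by
    intro z
    rw [show (π:ℂ) * (1/2 + z) = π * z + π / 2 by ring, Complex.sin_add_pi_div_two]
  have s2 : ∀ z : ℂ, Complex.sin (π * (z - 1/2)) = -Complex.cos (π * z) := by
    intro z
    rw [show (π:ℂ) * (z - 1/2) = π * z - π / 2 by ring, Complex.sin_sub_pi_div_two]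
  have s3 : ∀ z : ℂ, Complex.sin (π * (-z)) = -Complex.sin (π * z) := by
    intro z; rw [mul_neg, Complex.sin_neg]
  have hval : blk (p / lam) u / blk (p / lam + 1) u =
      Complex.sin (π * y) / Complex.sin (π * y') * (Complex.cos (π * y') / Complex.cos (π * y)) := by
    unfold blk
    rw [show (u + ((π * (p / lam) : ℝ) : ℂ)) / 2 = π * y by
        rw [hy0, hu]; push_cast; field_simp; ring,
      show (u - ((π * (p / lam) : ℝ) : ℂ)) / 2 = -(π * y') by
        rw [hy0', hu]; push_cast; field_simp; ring,
      show (u + ((π * (p / lam + 1) : ℝ) : ℂ)) / 2 = π * y + π / 2 by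
        rw [hy0, hu]; push_cast; field_simp; ring,
      show (u - ((π * (p / lam + 1) : ℝ) : ℂ)) / 2 = -(π * y' + π / 2) by
        rw [hy0', hu]; push_cast; field_simp; ring]
    simp only [Complex.sin_neg, Complex.sin_add_pi_div_two]
    simp only [div_eq_mul_inv, mul_inv, inv_inv, inv_neg]
    ring
  rw [hval]
  constructor
  · have := (EE_ratio (-y) (-y') (by rw [s3]; simpa using n1)).mul
      (EE_ratio (1/2 + y') (1/2 + y) (by rw [s1]; exact n2))
    rw [s3, s3, s1, s1, neg_div_neg_eq] at this
    exact this.congr fun L => (zp_prod s lam p y y' hl' hy hy' L).symm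
  · have := (EE_ratio y y' n1).mul
      (EE_ratio (y' - 1/2) (y - 1/2) (by rw [s2]; simpa using n2))
    rw [s2, s2, neg_div_neg_eq] at this
    exact this.congr fun L => (wp_prod s lam p y y' hl' hy hy' L).symm

lemma sin_add_nat_pi (z : ℂ) (k : ℕ) :
    Complex.sin (z + (k : ℂ) * π) = (-1) ^ k * Complex.sin z := by
  induction k with
  | zero => simp
  | succ j ih =>
    rw [show z + ((j + 1 : ℕ) : ℂ) * π = z + (j : ℂ) * π + π by push_cast; ring,
      Complex.sin_add_pi, ih]
    ring

lemma kappa_core (a b c d e f : ℂ) (ha : a ≠ 0) (hb : b ≠ 0) :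
    a * b / (c * d) * (e * f / (b * a)) = e * f / (d * c) := by
  field_simp

lemma trig_core (R G rm rp D E sm sp L T : ℂ) (hE : E ≠ 0) (hsm : sm ≠ 0) (hsp : sp ≠ 0)
    (h : L ^ 2 - D ^ 2 = -T * sm) :
    R * (G * (-D / E)) * (D / sm * rm) * (E / sp * rp) + R * G * (L / sm * rm) * (L / sp * rp) =
      R * (G * (rm * rp) * (-T / sp)) := by
  field_simp
  linear_combination R * G * rm * rp * h

lemma a1_eq (lam ξ : ℝ) (n : ℕ) (u : ℂ) (m : ℝ) (hl : lam ≠ 0) (hm : m = ξ / π - n - 1/2) :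
    a1 lam ξ n u = ∏ k ∈ Finset.range n,
      ((blk ((m + k + 1) / lam) u / blk ((m + k + 1) / lam + 1) u) *
       (blk ((m + k) / lam) u / blk ((m + k) / lam + 1) u)) := by
  unfold a1
  rw [aux_prod_Icc, ← Finset.prod_range_reflect]
  refine Finset.prod_congr rfl fun k hk => ?_
  have hk' : k < n := Finset.mem_range.1 hk
  have e : ((n - 1 - k + 1 : ℕ) : ℝ) = n - k := by
    rw [show n - 1 - k + 1 = n - k by omega, Nat.cast_sub hk'.le]
  have hp := Real.pi_ne_zero
  have e1 : ξ / (lam * π) + 1 / (2 * lam) - ((n - 1 - k + 1 : ℕ) : ℝ) / lam = (m + k + 1) / lam := by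
    rw [e, hm]; field_simp; ring
  have e2 : ξ / (lam * π) - 1 / (2 * lam) - ((n - 1 - k + 1 : ℕ) : ℝ) / lam = (m + k) / lam := by
    rw [e, hm]; field_simp; ring
  rw [e1, e2, mul_div_mul_comm]

/-- Consequences of the convergence of `c` to a nonzero value. -/
lemma c_facts (lam : ℝ) (v C B : ℂ) (hC : Tendsto (cPartial lam v) atTop (𝓝 C)) (hC0 : C ≠ 0)
    (hB : Tendsto (bPartial lam v) atTop (𝓝 B)) (hB0 : B ≠ 0) :
    Complex.sin (lam * v) ≠ 0 ∧ Complex.sin (lam * (v - π)) ≠ 0 ∧ ∃ r : ℂ,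
      Tendsto (fun L => ∏ l ∈ Finset.Icc 1 L, rhoBlock lam v l) atTop (𝓝 r) ∧ r ≠ 0 ∧
      B = Complex.sin (lam * v) / Complex.sin (lam * (v - π)) * r ∧
      C = Complex.sin (lam * π) / Complex.sin (lam * (v - π)) * r := by
  obtain ⟨L1, h1⟩ := (hC.eventually_ne hC0).exists
  obtain ⟨L2, h2⟩ := (hB.eventually_ne hB0).exists
  have n1 : Complex.sin (lam * v) ≠ 0 := by
    intro h0; apply h2; simp [bPartial, h0]
  have n2 : Complex.sin (lam * (v - π)) ≠ 0 := by
    intro h0; apply h2; simp [bPartial, h0]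
  have n3 : Complex.sin (lam * π) ≠ 0 := by
    intro h0; apply h1; simp [cPartial, h0]
  have hr : Tendsto (fun L => ∏ l ∈ Finset.Icc 1 L, rhoBlock lam v l) atTop
      (𝓝 (C * (Complex.sin (lam * (v - π)) / Complex.sin (lam * π)))) := by
    refine (hC.mul_const _).congr fun L => ?_
    unfold cPartial
    field_simp
  refine ⟨n1, n2, _, hr, mul_ne_zero hC0 (div_ne_zero n2 n3), ?_, by field_simp⟩
  refine tendsto_nhds_unique hB ?_
  refine (hr.const_mul _).congr fun L => ?_
  unfold bPartial
  ring

/-- The boundary-bootstrap identity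
`P^-(u) b(u−ν_n) b(u+ν_n) + P^+(u) c(u−ν_n) c(u+ν_n) = \bar{P^+}(u) a^1_n(u)`, valid at
every complex `u` at which all the infinite products involved converge to nonzero
values.  Here `P^± = R_0 · G^±`, `G^-` is `G^+` with `ξ ↦ −ξ`, and
`\bar{P^+} = R_0 · G^+|_{ξ → π(λ+1)−ξ}`. -/
theorem stmt5 (lam ξ : ℝ) (hlam : 1 < lam) (hxi0 : 0 < ξ)
    (hxi1 : ξ < Real.pi * (lam + 1) / 2) (n : ℕ) (u : ℂ)
    (R0v Gp Gm Gpbar Bm Bp Cm Cp : ℂ)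
    (hR0 : Tendsto (r0Partial lam u) atTop (𝓝 R0v)) (hR00 : R0v ≠ 0)
    (hGp : Tendsto (gPartial lam ξ u) atTop (𝓝 Gp)) (hGp0 : Gp ≠ 0)
    (hGm : Tendsto (gPartial lam (-ξ) u) atTop (𝓝 Gm)) (hGm0 : Gm ≠ 0)
    (hGpbar : Tendsto (gPartial lam (Real.pi * (lam + 1) - ξ) u) atTop (𝓝 Gpbar))
    (hGpbar0 : Gpbar ≠ 0)
    (hBm : Tendsto (bPartial lam (u - (nuP lam ξ n : ℝ))) atTop (𝓝 Bm)) (hBm0 : Bm ≠ 0)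
    (hBp : Tendsto (bPartial lam (u + (nuP lam ξ n : ℝ))) atTop (𝓝 Bp)) (hBp0 : Bp ≠ 0)
    (hCm : Tendsto (cPartial lam (u - (nuP lam ξ n : ℝ))) atTop (𝓝 Cm)) (hCm0 : Cm ≠ 0)
    (hCp : Tendsto (cPartial lam (u + (nuP lam ξ n : ℝ))) atTop (𝓝 Cp)) (hCp0 : Cp ≠ 0) :
    (R0v * Gm) * Bm * Bp + (R0v * Gp) * Cm * Cp = (R0v * Gpbar) * a1 lam ξ n u := by
  have hp : (π : ℂ) ≠ 0 := by exact_mod_cast Real.pi_ne_zero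
  have hl : lam ≠ 0 := by linarith
  have hl' : (lam : ℂ) ≠ 0 := by exact_mod_cast hl
  obtain ⟨sm0, sigm0, rm, hrm, hrm0, eBm, eCm⟩ := c_facts lam _ Cm Bm hCm hCm0 hBm hBm0
  obtain ⟨sp0, sigp0, rp, hrp, hrp0, eBp, eCp⟩ := c_facts lam _ Cp Bp hCp hCp0 hBp hBp0
  set s : ℂ := lam * u / π with hs
  obtain ⟨mr, hmr⟩ : ∃ mr : ℝ, mr = ξ / π - n - 1/2 := ⟨_, rfl⟩
  set m : ℂ := (mr : ℂ) with hm
  have hnu : m = lam * ((nuP lam ξ n : ℝ) : ℂ) / π := by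
    have : mr = lam * nuP lam ξ n / π := by
      rw [hmr, nuP]; have := Real.pi_ne_zero; field_simp; ring
    rw [hm, this]; push_cast; rfl
  have hxm : (ξ : ℂ) / π = m + n + 1/2 := by
    rw [hm, hmr]; push_cast; ring
  -- nonvanishing of all blocks
  have kP := ne_of_tendsto_prod _ _ hGp hGp0
  have kM := ne_of_tendsto_prod _ _ hGm hGm0
  have kB := ne_of_tendsto_prod _ _ hGpbar hGpbar0
  have kR : ∀ i : ℕ, rhoBlock lam (u - (nuP lam ξ n : ℝ)) (i+1) *
      rhoBlock lam (u + (nuP lam ξ n : ℝ)) (i+1) ≠ 0 := fun i =>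
    mul_ne_zero (ne_of_tendsto_prod _ _ hrm hrm0 i) (ne_of_tendsto_prod _ _ hrp hrp0 i)
  -- rewriting of the blocks
  have fP : ∀ l : ℕ, gBlock lam ξ u l =
      gg s (1 + 2 * l * lam + m + n) * gg s ((2 * l - 2) * lam - m - n) /
      (gg s (1 + (2 * l - 1) * lam + m + n) * gg s ((2 * l - 1) * lam - m - n)) := by
    intro l
    rw [gBlock_eq lam ξ u s _ hs rfl l, hxm]
    congr 2 <;> congr 1 <;> ring
  have fM : ∀ l : ℕ, gBlock lam (-ξ) u l =
      gg s (2 * l * lam - m - n) * gg s (1 + (2 * l - 2) * lam + m + n) /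
      (gg s ((2 * l - 1) * lam - m - n) * gg s (1 + (2 * l - 1) * lam + m + n)) := by
    intro l
    rw [gBlock_eq lam (-ξ) u s (-(m + n + 1/2)) hs (by rw [← hxm]; push_cast; ring) l]
    congr 2 <;> congr 1 <;> ring
  have fB : ∀ l : ℕ, gBlock lam (π * (lam + 1) - ξ) u l =
      gg s (1 + (2 * l + 1) * lam - m - n) * gg s ((2 * l - 3) * lam + m + n) /
      (gg s (1 + 2 * l * lam - m - n) * gg s ((2 * l - 2) * lam + m + n)) := by
    intro l
    rw [gBlock_eq lam _ u s (lam + 1 - (m + n + 1/2)) hs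
      (by rw [← hxm]; push_cast; field_simp) l]
    congr 2 <;> congr 1 <;> ring
  have fR := fun l : ℕ => rhoBlock_eq lam u ((nuP lam ξ n : ℝ) : ℂ) s m hs hnu l
  simp only [fP, fM, fB, fR, div_ne_zero_iff, mul_ne_zero_iff] at kP kM kB kR
  -- structured nonvanishing
  have hU : ∀ j : ℕ, gg s (j * lam + m) ≠ 0 := by
    intro j
    rcases Nat.even_or_odd' j with ⟨c, rfl | rfl⟩
    · have := (kR c).2.1.1.1
      push_cast at this ⊢
      convert this using 2; ring
    · have := (kR c).1.1.1.1
      push_cast at this ⊢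
      convert this using 2; ring
  have hD : ∀ j : ℕ, gg s (j * lam - m - n) ≠ 0 := by
    intro j
    rcases Nat.even_or_odd' j with ⟨c, rfl | rfl⟩
    · have := (kP c).1.2
      push_cast at this ⊢
      convert this using 2; ring
    · have := (kP c).2.2
      push_cast at this ⊢
      convert this using 2; ring
  -- the exceptional index
  have hE : gg s (-lam + m) ≠ 0 := by
    have h1 : gg s (-lam + m + n) ≠ 0 := by
      have := (kB 0).1.2
      push_cast at this
      convert this using 2; ring
    have h2 : gg s (lam - m - n) ≠ 0 := by simpa using hD 1
    refine gg_ne_of s _ fun k => ?_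
    have A := fun j => gg_ne s _ h1 j
    have B := fun j => gg_ne s _ h2 j
    rcases le_or_gt k n with hk | hk
    · have hc : ((n - k : ℕ) : ℂ) = n - k := Nat.cast_sub hk
      constructor
      · intro h0
        apply (B (n - k)).2
        rw [hc]; linear_combination -h0
      · intro h0
        apply (B (n - k)).1
        rw [hc]; linear_combination -h0
    · have hc : ((k - n : ℕ) : ℂ) = k - n := Nat.cast_sub hk.le
      constructor
      · intro h0
        apply (A (k - n)).1
        rw [hc]; linear_combination h0
      · intro h0
        apply (A (k - n)).2
        rw [hc]; linear_combination h0
  have hU' : ∀ i : ℕ, gg s ((2 * ((i+1:ℕ):ℂ) - 3) * lam + m) ≠ 0 := by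
    intro i
    rcases i with _ | i
    · convert hE using 2; push_cast; ring
    · convert hU (2 * i + 1) using 2; push_cast; ring
  -- nondegeneracy of the trigonometric blocks
  have hnd : ∀ k : ℕ, k ≤ n → ∀ j : ℤ, m + k + j * lam + s ≠ 0 ∧ m + k + j * lam - s ≠ 0 := by
    intro k hk j
    rcases Int.le_total 0 j with hj | hj
    · obtain ⟨j, rfl⟩ := Int.eq_ofNat_of_zero_le hj
      have := gg_ne s _ (hU j) k
      push_cast
      constructor
      · intro h0; apply this.1; linear_combination h0
      · intro h0; apply this.2; linear_combination h0
    · obtain ⟨i, hi⟩ := Int.eq_ofNat_of_zero_le (neg_nonneg.2 hj)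
      obtain rfl : j = -(i:ℤ) := by omega
      have := gg_ne s _ (hD i) (n - k)
      rw [Nat.cast_sub hk] at this
      push_cast
      constructor
      · intro h0; apply this.2; linear_combination -h0
      · intro h0; apply this.1; linear_combination -h0
  -- limit of the trigonometric part
  have limT : Tendsto (fun L : ℕ => ∏ k ∈ Finset.range n, 
      ((∏ i ∈ Finset.range L, zp s lam ((i+1:ℕ):ℂ) (m + k + 1)) *
       (∏ i ∈ Finset.range L, wp s lam ((i+1:ℕ):ℂ) (m + k)))) atTop (𝓝 (a1 lam ξ n u)) := by
    rw [a1_eq lam ξ n u mr hl hmr]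
    refine tendsto_finsetProd _ fun k hk => ?_
    have hk' : k < n := Finset.mem_range.1 hk
    have h1 := (zp_wp_tendsto lam (mr + k + 1) u s hl hs (by
      intro j
      have := hnd (k+1) hk' j
      push_cast at this ⊢
      rw [← add_assoc] at this
      exact this)).1
    have h2 := (zp_wp_tendsto lam (mr + k) u s hl hs (by
      intro j
      have := hnd k hk'.le j
      push_cast at this ⊢
      exact this)).2
    push_cast at h1 h2 ⊢
    exact h1.mul h2
  -- telescoping, base part
  have limBase : Tendsto (fun L : ℕ => ∏ i ∈ Finset.range L,
      ((gg s (1 + (2 * ((i+1:ℕ):ℂ) + 1) * lam - m) * gg s ((2 * ((i+1:ℕ):ℂ) - 3) * lam + m)) /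
      (gg s (1 + (2 * ((i+1:ℕ):ℂ) - 1) * lam - m) * gg s ((2 * ((i+1:ℕ):ℂ) - 1) * lam + m)))) atTop
      (𝓝 (Complex.sin (π * (m - lam - s)) / Complex.sin (π * (m - lam + s)))) := by
    have t1 := tele (fun i : ℕ => gg s (1 + (2 * ((i+1:ℕ):ℂ) - 1) * lam - m)) (fun i => (kR i).1.2)
    have t2 := tele (fun i : ℕ => gg s ((2 * ((i+1:ℕ):ℂ) - 3) * lam + m)) hU'
    have T := (gg_ratio_tendsto s (1 + lam - m) (-lam + m) (2 * lam) (by linarith)).mul_const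
      (gg s (m - lam) / gg s (1 - (m - lam)))
    rw [gg_refl, one_mul, ← gg_refl] at T
    rw [← gg_refl]
    refine T.congr fun L => ?_
    have e : ∀ i : ℕ, 
      ((gg s (1 + (2 * ((i+1:ℕ):ℂ) + 1) * lam - m) * gg s ((2 * ((i+1:ℕ):ℂ) - 3) * lam + m)) /
      (gg s (1 + (2 * ((i+1:ℕ):ℂ) - 1) * lam - m) * gg s ((2 * ((i+1:ℕ):ℂ) - 1) * lam + m)))
      = (gg s (1 + (2 * ((i+1+1:ℕ):ℂ) - 1) * lam - m) / gg s (1 + (2 * ((i+1:ℕ):ℂ) - 1) * lam - m)) /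
        (gg s ((2 * ((i+1+1:ℕ):ℂ) - 3) * lam + m) / gg s ((2 * ((i+1:ℕ):ℂ) - 3) * lam + m)) := by
      intro i
      rw [show 1 + (2 * ((i+1+1:ℕ):ℂ) - 1) * lam - m = 1 + (2 * ((i+1:ℕ):ℂ) + 1) * lam - m by
        push_cast; ring, show (2 * ((i+1+1:ℕ):ℂ) - 3) * lam + m = (2 * ((i+1:ℕ):ℂ) - 1) * lam + m by
        push_cast; ring, div_div_div_eq]
    simp only [e]
    rw [Finset.prod_div_distrib, t1, t2]
    have e1 : (1 + (2 * ((L+1:ℕ):ℂ) - 1) * lam - m) = 1 + lam - m + ((2 * lam : ℝ):ℂ) * L := by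
      push_cast; ring
    have e2 : ((2 * ((L+1:ℕ):ℂ) - 3) * lam + m) = -lam + m + ((2 * lam : ℝ):ℂ) * L := by
      push_cast; ring
    have e3 : (1 + (2 * ((0+1:ℕ):ℂ) - 1) * lam - m) = 1 - (m - lam) := by
      push_cast; ring
    have e4 : ((2 * ((0+1:ℕ):ℂ) - 3) * lam + m) = m - lam := by
      push_cast; ring
    simp only [e1, e2, e3, e4]
    simp only [div_eq_mul_inv, mul_inv, inv_inv]
    ring
  -- telescoping, G^- versus G^+
  have limK : Tendsto (fun L : ℕ => ∏ i ∈ Finset.range L,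
      ((gg s (2 * ((i+1:ℕ):ℂ) * lam - m - n) * gg s (1 + (2 * ((i+1:ℕ):ℂ) - 2) * lam + m + n)) /
      (gg s ((2 * ((i+1:ℕ):ℂ) - 2) * lam - m - n) * gg s (1 + 2 * ((i+1:ℕ):ℂ) * lam + m + n)))) atTop
      (𝓝 (Complex.sin (π * (m - s)) / Complex.sin (π * (m + s)))) := by
    have t1 := tele (fun i : ℕ => gg s ((2 * ((i+1:ℕ):ℂ) - 2) * lam - m - n)) (fun i => (kP i).1.2)
    have t2 := tele (fun i : ℕ => gg s (1 + (2 * ((i+1:ℕ):ℂ) - 2) * lam + m + n))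
      (fun i => (kM i).1.2)
    have T := (gg_ratio_tendsto s (- m - n) (1 + m + n) (2 * lam) (by linarith)).mul_const
      (gg s (1 + m + n) / gg s (1 - (1 + m + n)))
    have hv : gg s (1 + m + n) / gg s (1 - (1 + m + n)) =
        Complex.sin (π * (m - s)) / Complex.sin (π * (m + s)) := by
      rw [gg_refl, show (π:ℂ) * (1 + m + n - s) = π * (m - s) + ((n + 1 : ℕ) : ℂ) * π by
          push_cast; ring,
        show (π:ℂ) * (1 + m + n + s) = π * (m + s) + ((n + 1 : ℕ) : ℂ) * π by
          push_cast; ring, sin_add_nat_pi, sin_add_nat_pi]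
      exact mul_div_mul_left _ _ (by simp)
    rw [hv, one_mul] at T
    refine T.congr fun L => ?_
    rw [← hv]
    have e : ∀ i : ℕ, 
      ((gg s (2 * ((i+1:ℕ):ℂ) * lam - m - n) * gg s (1 + (2 * ((i+1:ℕ):ℂ) - 2) * lam + m + n)) /
      (gg s ((2 * ((i+1:ℕ):ℂ) - 2) * lam - m - n) * gg s (1 + 2 * ((i+1:ℕ):ℂ) * lam + m + n)))
      = (gg s ((2 * ((i+1+1:ℕ):ℂ) - 2) * lam - m - n) / gg s ((2 * ((i+1:ℕ):ℂ) - 2) * lam - m - n)) /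
        (gg s (1 + (2 * ((i+1+1:ℕ):ℂ) - 2) * lam + m + n) /
          gg s (1 + (2 * ((i+1:ℕ):ℂ) - 2) * lam + m + n)) := by
      intro i
      rw [show (2 * ((i+1+1:ℕ):ℂ) - 2) = 2 * ((i+1:ℕ):ℂ) by push_cast; ring, div_div_div_eq]
    simp only [e]
    rw [Finset.prod_div_distrib, t1, t2]
    have e1 : ((2 * ((L+1:ℕ):ℂ) - 2) * lam - m - n) = - m - n + ((2 * lam : ℝ):ℂ) * L := by
      push_cast; ring
    have e2 : (1 + (2 * ((L+1:ℕ):ℂ) - 2) * lam + m + n) = 1 + m + n + ((2 * lam : ℝ):ℂ) * L := by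
      push_cast; ring
    have e3 : ((2 * ((0+1:ℕ):ℂ) - 2) * lam - m - n) = 1 - (1 + m + n) := by
      push_cast; ring
    have e4 : (1 + (2 * ((0+1:ℕ):ℂ) - 2) * lam + m + n) = 1 + m + n := by
      push_cast; ring
    simp only [e1, e2, e3, e4]
    simp only [div_eq_mul_inv, mul_inv, inv_inv]
    ring
  -- relation (1)
  have rel1 : Gm = Gp * (Complex.sin (π * (m - s)) / Complex.sin (π * (m + s))) := by
    refine tendsto_nhds_unique hGm ((hGp.mul limK).congr fun L => ?_)
    unfold gPartial
    rw [aux_prod_Icc, aux_prod_Icc, ← Finset.prod_mul_distrib]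
    refine Finset.prod_congr rfl fun i _ => ?_
    rw [fP, fM]
    exact kappa_core _ _ _ _ _ _ (kP i).1.1 (kP i).1.2
  -- relation (2)
  have rel2 : Gpbar * a1 lam ξ n u = Gp * (rm * rp) *
      (Complex.sin (π * (m - lam - s)) / Complex.sin (π * (m - lam + s))) := by
    refine tendsto_nhds_unique (hGpbar.mul limT)
      (((hGp.mul (hrm.mul hrp)).mul limBase).congr fun L => ?_)
    unfold gPartial
    simp only [← Finset.prod_mul_distrib]
    rw [Finset.prod_comm]
    simp only [aux_prod_Icc]
    simp only [← Finset.prod_mul_distrib]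
    refine Finset.prod_congr rfl fun i _ => ?_
    rw [fP, fB, fR]
    refine (block_id s m lam ((i+1:ℕ):ℂ) n (kB i).1.1 (hU' i) (kB i).2.1 (kR i).2.1.1.1
      (kR i).2.1.2 (kP i).1.2 (kR i).1.1.2 (kP i).2.2 (kR i).1.1.1.1 (kR i).1.2).symm
  -- trigonometry
  have q1 : (lam:ℂ) * (u - ((nuP lam ξ n : ℝ):ℂ)) = π * (s - m) := by
    rw [hs, hnu]; field_simp
  have q2 : (lam:ℂ) * (u + ((nuP lam ξ n : ℝ):ℂ)) = π * (s + m) := by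
    rw [hs, hnu]; field_simp
  have q3 : (lam:ℂ) * (u - ((nuP lam ξ n : ℝ):ℂ) - π) = π * (s - m) - π * lam := by
    rw [mul_sub, q1]; ring
  have q4 : (lam:ℂ) * (u + ((nuP lam ξ n : ℝ):ℂ) - π) = π * (m - lam + s) := by
    rw [mul_sub, q2]; ring
  rw [q1] at sm0 eBm
  rw [q2] at sp0 eBp
  rw [q3] at sigm0 eBm eCm
  rw [q4] at sigp0 eBp eCp
  rw [mul_assoc R0v Gpbar, rel2, rel1, eBm, eBp, eCm, eCp]
  rw [show s + m = m + s by ring] at sp0 ⊢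
  rw [show (π:ℂ) * (m - s) = -(π * (s - m)) by ring,
    show (π:ℂ) * (m - lam - s) = -(π * (s - m) + π * lam) by ring,
    show (lam:ℂ) * π = π * lam by ring]
  rw [Complex.sin_neg, Complex.sin_neg]
  have tr : Complex.sin (π * lam) ^ 2 - Complex.sin (π * (s - m)) ^ 2 =
      - Complex.sin (π * (s - m) + π * lam) * Complex.sin (π * (s - m) - π * lam) := by
    rw [Complex.sin_add, Complex.sin_sub]
    have c1 := Complex.sin_sq_add_cos_sq (π * (s - m))
    have c2 := Complex.sin_sq_add_cos_sq (π * lam)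
    linear_combination Complex.sin (π * (s - m)) ^ 2 * c2 - Complex.sin (π * lam) ^ 2 * c1
  exact trig_core _ _ _ _ _ _ _ _ _ _ sp0 sigm0 sigp0 tr
end

section
/- Assume λ > 1. The partial products defining R_0(u) converge, uniformly on compact subsets of the open strip {u ∈ ℂ : 0 < Re u < π/2} with the points Nπ/(2λ) (N = 1, 2, 3, …) removed, to a nonvanishing analytic function, and at each point u_N = Nπ/(2λ) with N ≥ 1 and Nπ/(2λ) < π/2 the function R_0 has a simple pole: (u − u_N)·R_0(u) tends to a finite nonzero limit as u → u_N. In particular, in the open strip R_0 has no zeroes and no poles other than the points Nπ/(2λ). -/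
open Complex Real Filter Topology

/-- The open physical strip `0 < Re u < π/2`. -/
def physStrip : Set ℂ := {u : ℂ | 0 < u.re ∧ u.re < Real.pi / 2}

/-- The candidate pole points `Nπ/(2λ)`, `N = 1, 2, 3, …`, of `R_0`. -/
def r0Poles (lam : ℝ) : Set ℂ :=
  {u : ℂ | ∃ N : ℕ, 1 ≤ N ∧ u = (((N : ℝ) * Real.pi / (2 * lam) : ℝ) : ℂ)}

/-- Quotients of Gamma functions as a limit of products (Euler). -/
lemma aux_gamma_quot (a1 a2 a3 a4 b1 b2 b3 b4 : ℂ) (hsum : a1 + a2 + a3 + a4 = b1 + b2 + b3 + b4)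
    (h1 : 0 < b1.re) (h2 : 0 < b2.re) (h3 : 0 < b3.re) (h4 : 0 < b4.re) :
    Tendsto (fun n : ℕ => ∏ j ∈ Finset.range (n + 1),
      (((b1 + j) * (b2 + j) * (b3 + j) * (b4 + j)) / ((a1 + j) * (a2 + j) * (a3 + j) * (a4 + j))))
      atTop (𝓝 ((Complex.Gamma a1 * Complex.Gamma a2 * Complex.Gamma a3 * Complex.Gamma a4) /
        (Complex.Gamma b1 * Complex.Gamma b2 * Complex.Gamma b3 * Complex.Gamma b4))) := by
  have hb : Complex.Gamma b1 * Complex.Gamma b2 * Complex.Gamma b3 * Complex.Gamma b4 ≠ 0 := by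
    simp only [ne_eq, mul_eq_zero, not_or]
    exact ⟨⟨⟨Complex.Gamma_ne_zero_of_re_pos h1, Complex.Gamma_ne_zero_of_re_pos h2⟩,
      Complex.Gamma_ne_zero_of_re_pos h3⟩, Complex.Gamma_ne_zero_of_re_pos h4⟩
  have T := Complex.GammaSeq_tendsto_Gamma
  have key := ((((T a1).mul (T a2)).mul (T a3)).mul (T a4)).div
    ((((T b1).mul (T b2)).mul (T b3)).mul (T b4)) hb
  refine key.congr' ?_
  filter_upwards [eventually_ge_atTop 1] with n hn
  have hn0 : (n : ℂ) ≠ 0 := by exact_mod_cast (by omega : n ≠ 0)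
  have hf : ((n.factorial : ℕ) : ℂ) ≠ 0 := by exact_mod_cast n.factorial_ne_zero
  simp only [Pi.div_apply, Complex.GammaSeq, Finset.prod_div_distrib, Finset.prod_mul_distrib]
  have hp : (n : ℂ) ^ a1 * (n : ℂ) ^ a2 * (n : ℂ) ^ a3 * (n : ℂ) ^ a4
      = (n : ℂ) ^ b1 * (n : ℂ) ^ b2 * (n : ℂ) ^ b3 * (n : ℂ) ^ b4 := by
    simp only [← Complex.cpow_add _ _ hn0, hsum]
  have hc : ∀ s : ℂ, (n : ℂ) ^ s ≠ 0 := fun s => by simp [Complex.cpow_eq_zero_iff, hn0]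
  have hbn : ∀ b : ℂ, 0 < b.re → ∏ j ∈ Finset.range (n + 1), (b + (j : ℂ)) ≠ 0 := by
    intro b hb
    refine Finset.prod_ne_zero_iff.mpr fun j _ h => ?_
    have := congrArg Complex.re h
    simp at this
    have : (0:ℝ) ≤ j := Nat.cast_nonneg j
    linarith
  have g1 := hbn b1 h1
  have g2 := hbn b2 h2
  have g3 := hbn b3 h3
  have g4 := hbn b4 h4
  generalize (∏ j ∈ Finset.range (n + 1), (b1 + (j : ℂ))) = q1 at *
  generalize (∏ j ∈ Finset.range (n + 1), (b2 + (j : ℂ))) = q2 at *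
  generalize (∏ j ∈ Finset.range (n + 1), (b3 + (j : ℂ))) = q3 at *
  generalize (∏ j ∈ Finset.range (n + 1), (b4 + (j : ℂ))) = q4 at *
  generalize (∏ j ∈ Finset.range (n + 1), (a1 + (j : ℂ))) = p1
  generalize (∏ j ∈ Finset.range (n + 1), (a2 + (j : ℂ))) = p2
  generalize (∏ j ∈ Finset.range (n + 1), (a3 + (j : ℂ))) = p3
  generalize (∏ j ∈ Finset.range (n + 1), (a4 + (j : ℂ))) = p4
  have e1 : ∀ x1 x2 x3 x4 r1 r2 r3 r4 f : ℂ, x1 * f / r1 * (x2 * f / r2) * (x3 * f / r3) *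
      (x4 * f / r4) = (x1 * x2 * x3 * x4) * f ^ 4 / (r1 * r2 * r3 * r4) := by
    intros; simp only [div_eq_mul_inv, mul_inv]; ring
  rw [e1, e1, hp]
  have hne : (n : ℂ) ^ b1 * (n : ℂ) ^ b2 * (n : ℂ) ^ b3 * (n : ℂ) ^ b4 *
      ((n.factorial : ℕ) : ℂ) ^ 4 ≠ 0 := by
    simp [hc, hf]
  rw [div_div_div_cancel_left' _ _ hne]

lemma aux_norm_ge (w : ℂ) (c : ℝ) (h : c ≤ w.re) : c ≤ ‖w‖ :=
  h.trans (Complex.re_le_norm w)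

/-- The one-step factor is `1 + O(x⁻³)`. -/
lemma aux_step (l B x : ℝ) (z : ℂ) (hl : 1 < l) (hx : 4 * l ≤ x) (hz0 : 0 < z.re) (hz1 : z.re < l)
    (hB : ‖z‖ ≤ B) :
    ‖((l + x - z) * (1 + 3 * l + x - z) * (1 + x + z) * (4 * l + x + z)) /
      ((1 + x - z) * (4 * l + x - z) * (l + x + z) * (1 + 3 * l + x + z)) - 1‖
      ≤ 32 * l * (l - 1) * B / x ^ 3 := by
  have hx0 : 0 < x := by linarith
  have q1 : 3 / 4 * x ≤ ‖(1 + x - z : ℂ)‖ := aux_norm_ge _ _ (by simp; linarith)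
  have q2 : x ≤ ‖(4 * l + x - z : ℂ)‖ := aux_norm_ge _ _ (by simp; linarith)
  have q3 : x ≤ ‖(l + x + z : ℂ)‖ := aux_norm_ge _ _ (by simp; linarith)
  have q4 : x ≤ ‖(1 + 3 * l + x + z : ℂ)‖ := aux_norm_ge _ _ (by simp; linarith)
  have hQ : 3 / 4 * x * x * x * x ≤
      ‖((1 + x - z) * (4 * l + x - z) * (l + x + z) * (1 + 3 * l + x + z) : ℂ)‖ := by
    rw [norm_mul, norm_mul, norm_mul]
    gcongr
  have hQ0 : ((1 + x - z) * (4 * l + x - z) * (l + x + z) * (1 + 3 * l + x + z) : ℂ) ≠ 0 := by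
    rw [← norm_pos_iff]
    exact lt_of_lt_of_le (by positivity) hQ
  rw [div_sub_one hQ0, norm_div]
  have hnum : ((l + x - z) * (1 + 3 * l + x - z) * (1 + x + z) * (4 * l + x + z) -
      (1 + x - z) * (4 * l + x - z) * (l + x + z) * (1 + 3 * l + x + z) : ℂ) =
      ((6 * l * (l - 1) * (2 * x + 4 * l + 1) : ℝ) : ℂ) * z := by
    push_cast; ring
  rw [hnum, norm_mul, Complex.norm_real, Real.norm_of_nonneg
    (by have : 0 < l - 1 := by linarith
        positivity)]
  have hl1 : 0 < l - 1 := by linarith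
  have hB0 : 0 ≤ B := (norm_nonneg z).trans hB
  calc _ ≤ (6 * l * (l - 1) * (4 * x)) * B / (3 / 4 * x * x * x * x) := by
        gcongr
        linarith
    _ = _ := by field_simp; ring

lemma aux_block (l B : ℝ) (z : ℂ) (hl : 1 < l) (hz0 : 0 < z.re) (hz1 : z.re < l)
    (hB : ‖z‖ ≤ B) (x : ℝ) (m : ℕ) (hm : 1 ≤ m) (hxm : (m : ℝ) ≤ x) (hx : 4 * l ≤ x) :
    ‖(Complex.Gamma (1 + x - z) * Complex.Gamma (4 * l + x - z) * Complex.Gamma (l + x + z) *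
        Complex.Gamma (1 + 3 * l + x + z)) /
      (Complex.Gamma (l + x - z) * Complex.Gamma (1 + 3 * l + x - z) * Complex.Gamma (1 + x + z) *
        Complex.Gamma (4 * l + x + z)) - 1‖
      ≤ Real.exp ((32 * l * (l - 1) * B * ∑' j : ℕ, 1 / ((j : ℝ) + 1) ^ (3 / 2 : ℝ)) *
        (1 / (m : ℝ) ^ (3 / 2 : ℝ))) - 1 := by
  have hl1 : 0 < l - 1 := by linarith
  have hB0 : 0 ≤ B := (norm_nonneg z).trans hB
  have hm0 : (0 : ℝ) < m := by exact_mod_cast hm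
  have hS : Summable (fun j : ℕ => 1 / ((j : ℝ) + 1) ^ (3 / 2 : ℝ)) := by
    have := (summable_nat_add_iff 1).mpr
      (Real.summable_one_div_nat_rpow (p := 3 / 2) |>.mpr (by norm_num))
    simpa using this
  have T := aux_gamma_quot (1 + x - z) (4 * l + x - z) (l + x + z) (1 + 3 * l + x + z)
    (l + x - z) (1 + 3 * l + x - z) (1 + x + z) (4 * l + x + z) (by ring)
    (by simp; linarith) (by simp; linarith) (by simp; linarith) (by simp; linarith)
  refine le_of_tendsto (T.sub_const 1).norm (Eventually.of_forall fun n => ?_)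
  set r : ℕ → ℂ := fun j => ((l + x - z + j) * (1 + 3 * l + x - z + j) * (1 + x + z + j) *
      (4 * l + x + z + j)) /
      ((1 + x - z + j) * (4 * l + x - z + j) * (l + x + z + j) * (1 + 3 * l + x + z + j)) - 1
    with hr
  have hrj : ∀ j, ‖r j‖ ≤ 32 * l * (l - 1) * B * (1 / (m : ℝ) ^ (3 / 2 : ℝ)) *
      (1 / ((j : ℝ) + 1) ^ (3 / 2 : ℝ)) := by
    intro j
    have hj : (0 : ℝ) ≤ j := Nat.cast_nonneg j
    have := aux_step l B (x + j) z hl (by linarith) hz0 hz1 hB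
    have e : r j = ((l + (x + j : ℝ) - z) * (1 + 3 * l + (x + j : ℝ) - z) * (1 + (x + j : ℝ) + z) *
        (4 * l + (x + j : ℝ) + z)) /
      ((1 + (x + j : ℝ) - z) * (4 * l + (x + j : ℝ) - z) * (l + (x + j : ℝ) + z) *
        (1 + 3 * l + (x + j : ℝ) + z)) - 1 := by
      simp only [hr]; push_cast; ring
    rw [e]
    refine this.trans ?_
    have h3 : (m : ℝ) ^ (3 / 2 : ℝ) * ((j : ℝ) + 1) ^ (3 / 2 : ℝ) ≤ (x + j) ^ 3 := by
      have : (x + j) ^ 3 = (x + j) ^ (3 / 2 : ℝ) * (x + j) ^ (3 / 2 : ℝ) := by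
        rw [← Real.rpow_add (by linarith), ← Real.rpow_natCast]; norm_num
      rw [this]
      refine mul_le_mul ?_ ?_ (by positivity) (Real.rpow_nonneg (by linarith) _)
      · exact Real.rpow_le_rpow (by positivity) (by linarith) (by norm_num)
      · exact Real.rpow_le_rpow (by positivity) (by linarith) (by norm_num)
    calc _ ≤ 32 * l * (l - 1) * B / ((m : ℝ) ^ (3 / 2 : ℝ) * ((j : ℝ) + 1) ^ (3 / 2 : ℝ)) := by
          gcongr
      _ = _ := by field_simp
  have e2 := Finset.norm_prod_one_add_sub_one_le (Finset.range (n + 1)) r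
  have e3 : ∀ j : ℕ, 1 + r j = ((l + x - z + j) * (1 + 3 * l + x - z + j) * (1 + x + z + j) *
      (4 * l + x + z + j)) /
      ((1 + x - z + j) * (4 * l + x - z + j) * (l + x + z + j) * (1 + 3 * l + x + z + j)) := by
    intro j; simp only [hr]; ring
  simp only [e3] at e2
  refine e2.trans ?_
  gcongr
  calc _ ≤ ∑ j ∈ Finset.range (n + 1), 32 * l * (l - 1) * B * (1 / (m : ℝ) ^ (3 / 2 : ℝ)) *
      (1 / ((j : ℝ) + 1) ^ (3 / 2 : ℝ)) := Finset.sum_le_sum fun j _ => hrj j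
    _ = 32 * l * (l - 1) * B * (1 / (m : ℝ) ^ (3 / 2 : ℝ)) * ∑ j ∈ Finset.range (n + 1),
      (1 / ((j : ℝ) + 1) ^ (3 / 2 : ℝ)) := by rw [Finset.mul_sum]
    _ ≤ 32 * l * (l - 1) * B * (1 / (m : ℝ) ^ (3 / 2 : ℝ)) * ∑' j : ℕ,
      (1 / ((j : ℝ) + 1) ^ (3 / 2 : ℝ)) := by
        gcongr
        exact hS.sum_le_tsum _ (fun j _ => by positivity)
    _ = _ := by ring

lemma aux_exp (t c : ℝ) (ht : 0 ≤ t) (hc : t ≤ c) : Real.exp t - 1 ≤ t * Real.exp c := by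
  have h1 : 1 - t ≤ Real.exp (-t) := Real.one_sub_le_exp_neg t
  have h2 : Real.exp t * Real.exp (-t) = 1 := by rw [← Real.exp_add]; simp
  have h3 : Real.exp t ≤ Real.exp c := Real.exp_le_exp.mpr hc
  nlinarith [Real.exp_pos t]

/-- The block without its first Gamma factor. -/
noncomputable def auxH (l x : ℝ) (u : ℂ) : ℂ :=
  (Complex.Gamma (4 * l + x - 2 * l * u / (π : ℂ)) *
    Complex.Gamma (l + x + 2 * l * u / (π : ℂ)) *
    Complex.Gamma (1 + 3 * l + x + 2 * l * u / (π : ℂ))) /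
  (Complex.Gamma (l + x - 2 * l * u / (π : ℂ)) *
    Complex.Gamma (1 + 3 * l + x - 2 * l * u / (π : ℂ)) *
    Complex.Gamma (1 + x + 2 * l * u / (π : ℂ)) *
    Complex.Gamma (4 * l + x + 2 * l * u / (π : ℂ)))

lemma aux_z_re (l : ℝ) (u : ℂ) : (2 * l * u / (π : ℂ)).re = 2 * l * u.re / π := by
  rw [show (2 * l * u / (π : ℂ)) = ((2 * l / π : ℝ) : ℂ) * u by push_cast; ring,
    Complex.re_ofReal_mul]
  ring

lemma aux_z_strip (l : ℝ) (hl : 1 < l) (u : ℂ) (hu : u ∈ physStrip) :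
    0 < (2 * l * u / (π : ℂ)).re ∧ (2 * l * u / (π : ℂ)).re < l := by
  rw [aux_z_re]
  obtain ⟨h0, h1⟩ := hu
  have := Real.pi_pos
  constructor
  · positivity
  · rw [div_lt_iff₀ this]
    nlinarith

lemma aux_diff_Gamma (s : ℂ) (hs : 0 < s.re) : DifferentiableAt ℂ Complex.Gamma s := by
  refine Complex.differentiableAt_Gamma s fun m h => ?_
  rw [h] at hs
  simp at hs
  have : (0 : ℝ) ≤ m := Nat.cast_nonneg m
  linarith

lemma auxH_ne (l x : ℝ) (hl : 1 < l) (hx : 0 ≤ x) (u : ℂ) (hu : u ∈ physStrip) :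
    auxH l x u ≠ 0 := by
  obtain ⟨h0, h1⟩ := aux_z_strip l hl u hu
  unfold auxH
  generalize 2 * l * u / (π : ℂ) = z at *
  refine div_ne_zero (mul_ne_zero (mul_ne_zero ?_ ?_) ?_)
    (mul_ne_zero (mul_ne_zero (mul_ne_zero ?_ ?_) ?_) ?_) <;>
  · refine Complex.Gamma_ne_zero_of_re_pos ?_
    simp
    linarith

lemma auxH_diff (l x : ℝ) (hl : 1 < l) (hx : 0 ≤ x) (u : ℂ) (hu : u ∈ physStrip) :
    DifferentiableAt ℂ (auxH l x) u := by
  obtain ⟨h0, h1⟩ := aux_z_strip l hl u hu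
  have hm : ∀ c : ℝ, l ≤ c →
      DifferentiableAt ℂ (fun u : ℂ => Complex.Gamma (c - 2 * l * u / (π : ℂ))) u := by
    intro c hc
    refine DifferentiableAt.comp u (aux_diff_Gamma _ ?_) (by fun_prop)
    rw [Complex.sub_re, Complex.ofReal_re]
    linarith
  have hp : ∀ c : ℝ, 0 ≤ c →
      DifferentiableAt ℂ (fun u : ℂ => Complex.Gamma (c + 2 * l * u / (π : ℂ))) u := by
    intro c hc
    refine DifferentiableAt.comp u (aux_diff_Gamma _ ?_) (by fun_prop)
    rw [Complex.add_re, Complex.ofReal_re]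
    linarith
  have m1 := hm (4 * l + x) (by linarith)
  have m2 := hp (l + x) (by linarith)
  have m3 := hp (1 + 3 * l + x) (by linarith)
  have m4 := hm (l + x) (by linarith)
  have m5 := hm (1 + 3 * l + x) (by linarith)
  have m6 := hp (1 + x) (by linarith)
  have m7 := hp (4 * l + x) (by linarith)
  push_cast at m1 m2 m3 m4 m5 m6 m7
  refine ((m1.mul m2).mul m3).div (((m4.mul m5).mul m6).mul m7) ?_
  have := auxH_ne l x hl hx u hu
  unfold auxH at this
  intro h
  apply this
  try simp only [Pi.mul_apply] at h
  rw [h, div_zero]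

lemma aux_r0Block_eq (l : ℝ) (u : ℂ) (m : ℕ) :
    r0Block l u (m + 1) =
      Complex.Gamma (1 + (4 * l * m : ℝ) - 2 * l * u / (π : ℂ)) * auxH l (4 * l * m) u := by
  unfold r0Block auxH
  rw [← mul_div_assoc]
  push_cast
  congr 1
  · rw [← mul_assoc, ← mul_assoc]
    congr 1
    · congr 1
      · congr 2 <;> ring
      · congr 1; ring
    · congr 1; ring
  · congr 1
    · congr 1
      · congr 2 <;> ring
      · congr 1; ring
    · congr 1; ring

/-- Blocks `k ≥ 2` are analytic and nonvanishing in the strip. -/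
lemma aux_block_diff (l : ℝ) (hl : 1 < l) (u : ℂ) (hu : u ∈ physStrip) (m : ℕ) :
    DifferentiableAt ℂ (fun u => r0Block l u (m + 1 + 1)) u ∧ r0Block l u (m + 1 + 1) ≠ 0 := by
  obtain ⟨h0, h1⟩ := aux_z_strip l hl u hu
  have hm : (0 : ℝ) ≤ m := Nat.cast_nonneg m
  have hx : 4 * l ≤ 4 * l * ((m + 1 : ℕ) : ℝ) := by push_cast; nlinarith
  have hre : 0 < (1 + (4 * l * ((m + 1 : ℕ) : ℝ) : ℝ) - 2 * l * u / (π : ℂ)).re := by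
    rw [Complex.sub_re, Complex.add_re, Complex.ofReal_re, Complex.one_re]
    linarith
  simp only [aux_r0Block_eq]
  refine ⟨DifferentiableAt.mul ?_ (auxH_diff l _ hl (by linarith) u hu),
    mul_ne_zero (Complex.Gamma_ne_zero_of_re_pos hre) (auxH_ne l _ hl (by linarith) u hu)⟩
  exact DifferentiableAt.comp u (aux_diff_Gamma _ hre) (by fun_prop)

lemma aux_notpole (l : ℝ) (hl : 1 < l) (u : ℂ) (hu : u ∉ r0Poles l) (m : ℕ) :
    1 + ((4 * l * (0 : ℕ) : ℝ) : ℂ) - 2 * l * u / (π : ℂ) ≠ -m := by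
  intro h
  apply hu
  refine ⟨m + 1, by omega, ?_⟩
  have hpi : (π : ℂ) ≠ 0 := by exact_mod_cast Real.pi_ne_zero
  have hl0 : (l : ℂ) ≠ 0 := by exact_mod_cast (by linarith : l ≠ 0)
  push_cast at h ⊢
  field_simp at h ⊢
  linear_combination -h

lemma aux_block1_diff (l : ℝ) (hl : 1 < l) (u : ℂ) (hu : u ∈ physStrip \ r0Poles l) :
    DifferentiableAt ℂ (fun u => r0Block l u 1) u ∧ r0Block l u 1 ≠ 0 := by
  have e : ∀ u, r0Block l u 1 = _ := fun u => aux_r0Block_eq l u 0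
  simp only [e]
  refine ⟨DifferentiableAt.mul ?_ (auxH_diff l _ hl (by simp) u hu.1),
    mul_ne_zero (Complex.Gamma_ne_zero (aux_notpole l hl u hu.2))
      (auxH_ne l _ hl (by simp) u hu.1)⟩
  exact DifferentiableAt.comp u (Complex.differentiableAt_Gamma _ (aux_notpole l hl u hu.2))
    (by fun_prop)

/-- Summable bound of the blocks, uniform in bounded parts of the strip. -/
lemma aux_bound (l B : ℝ) (hl : 1 < l) : ∃ v : ℕ → ℝ, Summable v ∧
    ∀ m : ℕ, ∀ u ∈ physStrip, ‖u‖ ≤ B → ‖r0Block l u (m + 1 + 1) - 1‖ ≤ v m := by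
  by_cases hB : 0 ≤ B
  swap
  · exact ⟨fun _ => 0, summable_zero, fun m u _ hu => absurd ((norm_nonneg u).trans hu) hB⟩
  set c : ℝ := 32 * l * (l - 1) * (2 * l * B / π) *
    ∑' j : ℕ, 1 / ((j : ℝ) + 1) ^ (3 / 2 : ℝ) with hc
  have hc0 : 0 ≤ c := by
    have : 0 < l - 1 := by linarith
    have hpi := Real.pi_pos
    have : 0 ≤ ∑' j : ℕ, 1 / ((j : ℝ) + 1) ^ (3 / 2 : ℝ) := tsum_nonneg fun j => by positivity
    positivity
  have hS : Summable (fun j : ℕ => 1 / ((j + 1 : ℕ) : ℝ) ^ (3 / 2 : ℝ)) :=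
    (summable_nat_add_iff 1).mpr
      (Real.summable_one_div_nat_rpow (p := 3 / 2) |>.mpr (by norm_num))
  refine ⟨fun m => (1 / ((m + 1 : ℕ) : ℝ) ^ (3 / 2 : ℝ)) * (c * Real.exp c), hS.mul_right _, ?_⟩
  intro m u hu huB
  obtain ⟨h0, h1⟩ := aux_z_strip l hl u hu
  have hzB : ‖2 * l * u / (π : ℂ)‖ ≤ 2 * l * B / π := by
    have hpi := Real.pi_pos
    rw [show (2 * l * u / (π : ℂ)) = ((2 * l / π : ℝ) : ℂ) * u by push_cast; ring, norm_mul,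
      Complex.norm_real, Real.norm_of_nonneg (by positivity)]
    calc _ ≤ 2 * l / π * B := by gcongr
      _ = _ := by ring
  have hm : (0 : ℝ) ≤ m := Nat.cast_nonneg m
  have key := aux_block l _ _ hl h0 h1 hzB (4 * l * ((m + 1 : ℕ) : ℝ)) (m + 1) (by omega)
    (by push_cast; nlinarith) (by push_cast; nlinarith)
  rw [← hc] at key
  rw [aux_r0Block_eq, auxH, ← mul_div_assoc, ← mul_assoc, ← mul_assoc]
  refine key.trans ?_
  have ht : (1 : ℝ) ≤ ((m + 1 : ℕ) : ℝ) ^ (3 / 2 : ℝ) :=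
    Real.one_le_rpow (by push_cast; linarith) (by norm_num)
  have ht1 : 1 / ((m + 1 : ℕ) : ℝ) ^ (3 / 2 : ℝ) ≤ 1 := by
    rw [div_le_one (by linarith)]; exact ht
  refine (aux_exp _ c (by positivity) ?_).trans (le_of_eq (by ring))
  exact mul_le_of_le_one_right hc0 ht1

lemma aux_strip_open : IsOpen physStrip :=
  (isOpen_lt continuous_const Complex.continuous_re).inter
    (isOpen_lt Complex.continuous_re continuous_const)

/-- The infinite product of the blocks `k ≥ 2`. -/
noncomputable def auxG (l : ℝ) (u : ℂ) : ℂ := ∏' m : ℕ, (1 + (r0Block l u (m + 1 + 1) - 1))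

lemma auxG_unif (l : ℝ) (hl : 1 < l) (Kc : Set ℂ) (hK : Kc ⊆ physStrip) (hc : IsCompact Kc) :
    TendstoUniformlyOn (fun (N : ℕ) u => ∏ m ∈ Finset.range N, r0Block l u (m + 1 + 1))
      (auxG l) atTop Kc := by
  obtain ⟨B, hB⟩ := hc.isBounded.exists_norm_le
  obtain ⟨v, hv, hb⟩ := aux_bound l B hl
  have := (hv.hasProdUniformlyOn_nat_one_add (f := fun m u => r0Block l u (m + 1 + 1) - 1) hc
    (Eventually.of_forall fun m u hu => hb m u (hK hu) (hB u hu))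
    (fun m u hu => ((aux_block_diff l hl u (hK hu) m).1.continuousAt.sub
      continuousAt_const).continuousWithinAt)).tendstoUniformlyOn_finsetRange
  simpa [funext_iff, show auxG l = fun u => ∏' m : ℕ, (1 + (r0Block l u (m + 1 + 1) - 1)) from rfl]
    using this

lemma auxG_ne (l : ℝ) (hl : 1 < l) (u : ℂ) (hu : u ∈ physStrip) : auxG l u ≠ 0 := by
  obtain ⟨v, hv, hb⟩ := aux_bound l ‖u‖ hl
  refine tprod_one_add_ne_zero_of_summable (fun m => ?_)
    (Summable.of_nonneg_of_le (fun _ => norm_nonneg _) (fun m => hb m u hu le_rfl) hv)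
  simpa using (aux_block_diff l hl u hu m).2

lemma auxG_diff (l : ℝ) (hl : 1 < l) : DifferentiableOn ℂ (auxG l) physStrip := by
  have h : TendstoLocallyUniformlyOn
      (fun (N : ℕ) u => ∏ m ∈ Finset.range N, r0Block l u (m + 1 + 1)) (auxG l) atTop physStrip :=
    (tendstoLocallyUniformlyOn_iff_forall_isCompact aux_strip_open).mpr
      fun K hK hc => auxG_unif l hl K hK hc
  refine h.differentiableOn (Eventually.of_forall fun N => ?_) aux_strip_open
  exact DifferentiableOn.fun_finsetProd fun m _ u hu =>
    (aux_block_diff l hl u hu m).1.differentiableWithinAt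

lemma aux_partial (l : ℝ) (u : ℂ) (N : ℕ) :
    r0Partial l u (N + 1) = r0Block l u 1 * ∏ m ∈ Finset.range N, r0Block l u (m + 1 + 1) := by
  have h : r0Partial l u (N + 1) = ∏ m ∈ Finset.range (N + 1), r0Block l u (m + 1) := by
    unfold r0Partial
    rw [← Finset.Ico_succ_right_eq_Icc, Finset.prod_Ico_eq_prod_range]
    simp [add_comm]
  rw [h, Finset.prod_range_succ', mul_comm]

lemma aux_poles_closed (l : ℝ) (hl : 1 < l) : IsClosed (r0Poles l) := by
  have h : r0Poles l = (fun u : ℂ => 2 * l * u / (π : ℂ)) ⁻¹'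
      ((fun n : ℤ => (n : ℂ)) '' {n : ℤ | 1 ≤ n}) := by
    have hpi : (π : ℂ) ≠ 0 := by exact_mod_cast Real.pi_ne_zero
    have hl0 : (l : ℂ) ≠ 0 := by exact_mod_cast (by linarith : l ≠ 0)
    ext u
    constructor
    · rintro ⟨N, hN, rfl⟩
      refine ⟨N, by simpa using hN, ?_⟩
      push_cast
      field_simp
    · rintro ⟨n, hn, h⟩
      simp only [Set.mem_ofPred_eq] at hn
      lift n to ℕ using by omega
      refine ⟨n, by omega, ?_⟩
      simp only at h
      push_cast at h ⊢
      field_simp at h ⊢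
      linear_combination -h
  rw [h]
  refine IsClosed.preimage (by fun_prop) ?_
  exact Complex.isClosedEmbedding_intCast.isClosedMap _ (isClosed_discrete _)

lemma aux_pole (l : ℝ) (hl : 1 < l) (N : ℕ) (hN : 1 ≤ N) :
    ∃ c : ℂ, c ≠ 0 ∧ Tendsto (fun u : ℂ => (u - (((N : ℝ) * Real.pi / (2 * l) : ℝ) : ℂ)) *
      Complex.Gamma (1 - 2 * l * u / (π : ℂ)))
      (𝓝[≠] (((N : ℝ) * Real.pi / (2 * l) : ℝ) : ℂ)) (𝓝 c) := by
  have hpi : (π : ℂ) ≠ 0 := by exact_mod_cast Real.pi_ne_zero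
  have hl0 : (l : ℂ) ≠ 0 := by exact_mod_cast (by linarith : l ≠ 0)
  set p : ℂ := (((N : ℝ) * Real.pi / (2 * l) : ℝ) : ℂ) with hp
  have hzp : 2 * l * p / (π : ℂ) = N := by
    rw [hp]; push_cast; field_simp
  have hpp : 2 * l * p = N * π := by
    rw [hp]; push_cast; field_simp
  have hN0 : 0 < (N : ℂ).re := by simpa using (by omega : 0 < N)
  have hG : Complex.Gamma N ≠ 0 := Complex.Gamma_ne_zero_of_re_pos hN0
  have hcos : Complex.cos (2 * l * p) ≠ 0 := by
    intro h
    have h1 := Complex.sin_sq_add_cos_sq (2 * l * p)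
    rw [h, hpp, Complex.sin_nat_mul_pi] at h1
    simp at h1
  -- derivative of the sine
  have hd : HasDerivAt (fun u : ℂ => Complex.sin (2 * l * u)) (Complex.cos (2 * l * p) * (2 * l)) p := by
    have : HasDerivAt (fun u : ℂ => 2 * l * u) (2 * l : ℂ) p := by
      simpa using (hasDerivAt_id p).const_mul (2 * l : ℂ)
    exact this.csin
  have hs := hasDerivAt_iff_tendsto_slope.mp hd
  have hne : Complex.cos (2 * l * p) * (2 * l) ≠ 0 := by
    simp [hcos, hl0]
  have hs2 := hs.inv₀ hne
  have hg : Tendsto (fun u : ℂ => (π : ℂ) / Complex.Gamma (2 * l * u / (π : ℂ))) (𝓝[≠] p)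
      (𝓝 ((π : ℂ) / Complex.Gamma N)) := by
    refine Tendsto.mono_left ?_ nhdsWithin_le_nhds
    have hcg : ContinuousAt (fun u : ℂ => Complex.Gamma (2 * l * u / (π : ℂ))) p := by
      refine ContinuousAt.comp (g := Complex.Gamma) (aux_diff_Gamma _ ?_).continuousAt
        (by fun_prop)
      rw [hzp]; exact hN0
    have := (continuousAt_const (y := (π : ℂ))).div hcg (by rw [hzp]; exact hG)
    have h2 := this.tendsto
    simp only [Pi.div_apply, hzp] at h2
    exact h2
  refine ⟨_, mul_ne_zero (inv_ne_zero hne) (div_ne_zero hpi hG), (hs2.mul hg).congr' ?_⟩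
  have hnz : ∀ᶠ u in 𝓝[≠] p, 0 < (2 * l * u / (π : ℂ)).re := by
    refine nhdsWithin_le_nhds ?_
    have : ContinuousAt (fun u : ℂ => (2 * l * u / (π : ℂ)).re) p :=
      Complex.continuous_re.continuousAt.comp (by fun_prop)
    refine this.eventually_const_lt ?_
    change 0 < (2 * l * p / (π : ℂ)).re
    rw [hzp]; exact hN0
  filter_upwards [hnz] with u hu
  have hr := Complex.Gamma_mul_Gamma_one_sub (2 * l * u / (π : ℂ))
  have hGu := Complex.Gamma_ne_zero_of_re_pos hu
  rw [mul_div_cancel₀ _ hpi] at hr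
  have hr2 : Complex.Gamma (1 - 2 * l * u / (π : ℂ)) =
      π / Complex.sin (2 * l * u) / Complex.Gamma (2 * l * u / (π : ℂ)) := by
    rw [← hr]; field_simp
  have hsp : Complex.sin (2 * l * p) = 0 := by rw [hpp, Complex.sin_nat_mul_pi]
  rw [hr2, slope_def_field, hsp]
  simp only [div_eq_mul_inv, mul_inv, inv_inv, sub_zero]
  ring

/-- For `λ > 1`, the partial products defining `R_0(u)` converge, uniformly on compact
subsets of the open strip `0 < Re u < π/2` with the points `Nπ/(2λ)` removed, to a
nonvanishing analytic function, which has a simple pole at each point `Nπ/(2λ) < π/2`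
(`N ≥ 1`): `(u − Nπ/(2λ))·R_0(u)` tends to a finite nonzero limit there.  In particular,
in the open strip `R_0` has no zeroes and no poles other than the points `Nπ/(2λ)`. -/
theorem stmt12 (lam : ℝ) (hlam : 1 < lam) :
    ∃ R : ℂ → ℂ,
      (∀ Kc : Set ℂ, Kc ⊆ physStrip \ r0Poles lam → IsCompact Kc →
        TendstoUniformlyOn (fun K u => r0Partial lam u K) R atTop Kc) ∧
      (∀ u ∈ physStrip \ r0Poles lam, AnalyticAt ℂ R u ∧ R u ≠ 0) ∧
      (∀ N : ℕ, 1 ≤ N → (N : ℝ) * Real.pi / (2 * lam) < Real.pi / 2 →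
        ∃ c : ℂ, c ≠ 0 ∧
          Tendsto (fun u : ℂ => (u - (((N : ℝ) * Real.pi / (2 * lam) : ℝ) : ℂ)) * R u)
            (𝓝[≠] (((N : ℝ) * Real.pi / (2 * lam) : ℝ) : ℂ)) (𝓝 c)) := by
  refine ⟨fun u => r0Block lam u 1 * auxG lam u, ?_, ?_, ?_⟩
  · intro Kc hK hc
    have hKs : Kc ⊆ physStrip := fun u hu => (hK hu).1
    have hb : ContinuousOn (fun u => r0Block lam u 1) Kc := fun u hu =>
      (aux_block1_diff lam hlam u (hK hu)).1.continuousAt.continuousWithinAt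
    have hg : ContinuousOn (auxG lam) Kc := (auxG_diff lam hlam).continuousOn.mono hKs
    have h1 : TendstoLocallyUniformlyOn (fun (_ : ℕ) u => r0Block lam u 1)
        (fun u => r0Block lam u 1) atTop Kc := by
      refine TendstoUniformlyOn.tendstoLocallyUniformlyOn ?_
      exact fun v hv => Eventually.of_forall fun n x _ => refl_mem_uniformity hv
    have h2 := (h1.mul₀ (auxG_unif lam hlam Kc hKs hc).tendstoLocallyUniformlyOn hb hg)
    have h3 := (tendstoLocallyUniformlyOn_iff_tendstoUniformlyOn_of_compact hc).mp h2
    intro v hv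
    have h4 := h3 v hv
    filter_upwards [(tendsto_sub_atTop_nat 1).eventually h4, eventually_ge_atTop 1] with K hK1 hK2
    intro x hx
    have h5 := hK1 x hx
    obtain ⟨M, rfl⟩ : ∃ M, K = M + 1 := ⟨K - 1, by omega⟩
    rw [aux_partial]
    simpa using h5
  · intro u hu
    have hP : IsOpen (physStrip \ r0Poles lam) :=
      aux_strip_open.sdiff (aux_poles_closed lam hlam)
    refine ⟨?_, mul_ne_zero (aux_block1_diff lam hlam u hu).2 (auxG_ne lam hlam u hu.1)⟩
    refine DifferentiableOn.analyticAt (s := physStrip \ r0Poles lam) ?_ (hP.mem_nhds hu)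
    exact DifferentiableOn.mul
      (fun w hw => (aux_block1_diff lam hlam w hw).1.differentiableWithinAt)
      ((auxG_diff lam hlam).mono Set.sdiff_subset)
  · intro N hN hlt
    obtain ⟨c, hc, ht⟩ := aux_pole lam hlam N hN
    set p : ℂ := (((N : ℝ) * Real.pi / (2 * lam) : ℝ) : ℂ) with hp
    have hps : p ∈ physStrip := by
      refine ⟨?_, by rw [hp, Complex.ofReal_re]; exact hlt⟩
      rw [hp, Complex.ofReal_re]
      have := Real.pi_pos
      have : (0 : ℝ) < N := by exact_mod_cast hN
      positivity
    have hH := ((auxH_diff lam (4 * lam * (0 : ℕ)) hlam (by simp) p hps).continuousAt.tendsto).mono_left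
      (nhdsWithin_le_nhds (s := {p}ᶜ))
    have hG := (((auxG_diff lam hlam).differentiableAt
      (aux_strip_open.mem_nhds hps)).continuousAt.tendsto).mono_left
      (nhdsWithin_le_nhds (s := {p}ᶜ))
    refine ⟨_, mul_ne_zero (mul_ne_zero hc (auxH_ne lam _ hlam (by simp) p hps))
      (auxG_ne lam hlam p hps), ((ht.mul hH).mul hG).congr fun u => ?_⟩
    have e := aux_r0Block_eq lam u 0
    rw [zero_add] at e
    simp only [e]
    simp
    ring
end
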